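/- arXiv:2012.02249 — 2 statements merged into one kernel-verified Lean document; each statement's English description precedes it below -/
import Mathlib

section
/- Given a chain complex over F_2, there exists an integer lift whose homology groups are free abelian with ranks equal to the F_2 Betti numbers of the original complex; in particular the lifted complex has no torsion in its homology. -/
open Module in
/-- Every invertible matrix over `F₂` lifts to an integer matrix of unit determinant. -/
theorem exists_lift_matrix {n : Type} [Fintype n] [DecidableEq n]
    (A : Matrix n n (ZMod 2)) (hA : A.det ≠ 0) :
    ∃ B : Matrix n n ℤ, IsUnit B.det ∧ B.map (Int.castRingHom (ZMod 2)) = A := by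
  refine Matrix.diagonal_transvection_induction_of_det_ne_zero
    (fun A => ∃ B : Matrix n n ℤ, IsUnit B.det ∧ B.map (Int.castRingHom (ZMod 2)) = A) A hA
    ?_ ?_ ?_
  · intro D hD
    refine ⟨1, by simp, ?_⟩
    rw [Matrix.det_diagonal, Finset.prod_ne_zero_iff] at hD
    have h1 : D = 1 := by
      funext i
      have := hD i (Finset.mem_univ i)
      have key : ∀ x : ZMod 2, x ≠ 0 → x = 1 := by decide
      exact key _ this
    subst h1
    rw [Matrix.map_one _ (map_zero _) (map_one _)]
    exact Matrix.diagonal_one.symm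
  · intro t
    refine ⟨Matrix.transvection t.i t.j (t.c.val : ℤ), ?_, ?_⟩
    · rw [Matrix.det_transvection_of_ne _ _ t.hij]
      exact isUnit_one
    · ext a b
      simp [Matrix.transvection, Matrix.TransvectionStruct.toMatrix, Matrix.single_apply,
        Matrix.one_apply]
  · rintro A B - - ⟨A', hA, rfl⟩ ⟨B', hB, rfl⟩
    refine ⟨A' * B', ?_, ?_⟩
    · rw [Matrix.det_mul]; exact hA.mul hB
    · rw [Matrix.map_mul]

open Module in
/-- Every basis of `F₂ⁿ` lifts to a basis of `ℤⁿ`. -/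
theorem exists_lift_basis {ι : Type} [Fintype ι] {n : ℕ}
    (e : Basis ι (ZMod 2) (Fin n → ZMod 2)) :
    ∃ E : Basis ι ℤ (Fin n → ℤ), ∀ i k, ((E i k : ℤ) : ZMod 2) = e i k := by
  have hc : Fintype.card ι = Fintype.card (Fin n) := by
    rw [← finrank_eq_card_basis e]; simp
  let σ : ι ≃ Fin n := Fintype.equivOfCardEq hc
  let e' := e.reindex σ
  let A := (Pi.basisFun (ZMod 2) (Fin n)).toMatrix e'
  have hA : A.det ≠ 0 := by
    have := (Basis.is_basis_iff_det (Pi.basisFun (ZMod 2) (Fin n)) (v := e')).1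
      ⟨e'.linearIndependent, e'.span_eq⟩
    rw [Basis.det_apply] at this
    exact this.ne_zero
  obtain ⟨B, hB, hBA⟩ := exists_lift_matrix A hA
  have hb := (Basis.is_basis_iff_det (Pi.basisFun ℤ (Fin n)) (v := fun i k => B k i)).2 (by
    rw [Basis.det_apply]
    convert! hB)
  refine ⟨(Basis.mk hb.1 hb.2.ge).reindex σ.symm, fun i k => ?_⟩
  have h1 := congrFun (congrFun hBA k) (σ i)
  simp [A, Basis.toMatrix_apply, e'] at h1
  rw [Basis.reindex_apply, Equiv.symm_symm, Basis.mk_apply]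
  exact h1

open Module in
/-- Adapted basis over a field. -/
theorem exists_adapted {K U V W : Type} [Field K] [AddCommGroup U] [Module K U]
    [AddCommGroup V] [Module K V] [AddCommGroup W] [Module K W] [FiniteDimensional K V]
    (f : V →ₗ[K] W) (g : U →ₗ[K] V) (hfg : f ∘ₗ g = 0) {r s : ℕ}
    (v : Basis (Fin r) K (LinearMap.range g)) (w : Basis (Fin s) K (LinearMap.range f)) :
    ∃ (h : ℕ) (e : Basis ((Fin r ⊕ Fin h) ⊕ Fin s) K V),
      (∀ i, e (Sum.inl (Sum.inl i)) = v i) ∧ (∀ i, f (e (Sum.inl i)) = 0) ∧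
      (∀ k, f (e (Sum.inr k)) = w k) := by
  have hle : LinearMap.range g ≤ LinearMap.ker f := LinearMap.range_le_ker_iff.2 hfg
  let N := (LinearMap.range g).comap (LinearMap.ker f).subtype
  let v' : Basis (Fin r) K N := v.map (Submodule.comapSubtypeEquivOfLe hle).symm
  let q := finBasis K (LinearMap.ker f ⧸ N)
  let b := Basis.sumQuot v' q
  let w' := w.map f.quotKerEquivRange.symm
  let e := Basis.sumQuot b w'
  refine ⟨_, e, fun i => ?_, fun i => ?_, fun k => ?_⟩
  · simp only [e, b, v', Basis.sumQuot_inl, Basis.map_apply]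
    rfl
  · simp [e]
  · have h1 : Submodule.Quotient.mk (e (Sum.inr k)) = w' k := Basis.sumQuot_inr b w' k
    have h2 := congrArg (fun x => (f.quotKerEquivRange x : W)) h1
    simpa [w'] using h2

open Module in
theorem mem_span_of_repr {R V ι κ : Type} [CommRing R] [AddCommGroup V] [Module R V]
    [Fintype ι] [Fintype κ] (e : Basis (ι ⊕ κ) R V) (x : V) :
    (x ∈ Submodule.span R (Set.range fun i => e (Sum.inl i))) ↔
      ∀ k, e.repr x (Sum.inr k) = 0 := by
  constructor
  · intro hx k
    induction hx using Submodule.span_induction with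
    | mem x h => obtain ⟨i, rfl⟩ := h; simp
    | zero => simp
    | add x y _ _ hx hy => simp [hx, hy]
    | smul a x _ hx => simp [hx]
  · intro h
    rw [← e.sum_repr x, Fintype.sum_sum_type]
    simp only [h, zero_smul, Finset.sum_const_zero, add_zero]
    exact Submodule.sum_mem _ fun i _ =>
      Submodule.smul_mem _ _ (Submodule.subset_span ⟨i, rfl⟩)

open Module in
theorem mem_span_of_repr' {R V : Type} {r h s : ℕ} [CommRing R] [AddCommGroup V] [Module R V]
    (e : Basis ((Fin r ⊕ Fin h) ⊕ Fin s) R V) (x : V) :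
    (x ∈ Submodule.span R (Set.range fun i => e (Sum.inl (Sum.inl i)))) ↔
      (∀ k, e.repr x (Sum.inl (Sum.inr k)) = 0) ∧ (∀ k, e.repr x (Sum.inr k) = 0) := by
  have := mem_span_of_repr (e.reindex (Equiv.sumAssoc _ _ _)) x
  simpa using this

open Module in
theorem homology_equiv {R U V W : Type} [CommRing R] [AddCommGroup U] [Module R U]
    [AddCommGroup V] [Module R V] [AddCommGroup W] [Module R W]
    (f : V →ₗ[R] W) (g : U →ₗ[R] V) {r h s : ℕ}
    (e : Basis ((Fin r ⊕ Fin h) ⊕ Fin s) R V)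
    (hg : LinearMap.range g = Submodule.span R (Set.range fun i => e (Sum.inl (Sum.inl i))))
    (hf0 : ∀ i, f (e (Sum.inl i)) = 0)
    (hf1 : LinearIndependent R fun k => f (e (Sum.inr k))) :
    Nonempty ((↥(LinearMap.ker f) ⧸
      (LinearMap.range g).comap (LinearMap.ker f).subtype) ≃ₗ[R] (Fin h → R)) := by
  let φ : LinearMap.ker f →ₗ[R] (Fin h → R) :=
    (LinearMap.pi fun i => e.coord (Sum.inl (Sum.inr i))) ∘ₗ (LinearMap.ker f).subtype
  have hφ : ∀ x i, φ x i = e.repr x (Sum.inl (Sum.inr i)) := fun x i => rfl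
  have hsurj : Function.Surjective φ := by
    intro y
    refine ⟨⟨∑ i, y i • e (Sum.inl (Sum.inr i)), ?_⟩, ?_⟩
    · simp [hf0]
    · funext i
      rw [hφ]
      simp [Finsupp.single_apply]
  have hker : (LinearMap.range g).comap (LinearMap.ker f).subtype = LinearMap.ker φ := by
    ext x
    rw [Submodule.mem_comap, hg, Submodule.subtype_apply, mem_span_of_repr', LinearMap.mem_ker]
    have hx : ∀ k, e.repr (x : V) (Sum.inr k) = 0 := by
      have h1 : f (x : V) = 0 := x.2
      rw [← e.sum_repr (x : V), Fintype.sum_sum_type] at h1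
      simp only [map_add, map_sum, map_smul, hf0, smul_zero, Finset.sum_const_zero,
        zero_add] at h1
      exact Fintype.linearIndependent_iff.1 hf1 _ h1
    constructor
    · rintro ⟨h1, -⟩
      funext i
      exact h1 i
    · intro h1
      exact ⟨fun k => congrFun h1 k, hx⟩
  exact ⟨(Submodule.quotEquivOfEq _ _ hker).trans (φ.quotKerEquivOfSurjective hsurj)⟩

open Module in
theorem coker_equiv {R U V : Type} [CommRing R] [AddCommGroup U] [Module R U]
    [AddCommGroup V] [Module R V] (g : U →ₗ[R] V) {r h s : ℕ} (hs : s = 0)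
    (e : Basis ((Fin r ⊕ Fin h) ⊕ Fin s) R V)
    (hg : LinearMap.range g = Submodule.span R (Set.range fun i => e (Sum.inl (Sum.inl i)))) :
    Nonempty ((V ⧸ LinearMap.range g) ≃ₗ[R] (Fin h → R)) := by
  subst hs
  let φ : V →ₗ[R] (Fin h → R) := LinearMap.pi fun i => e.coord (Sum.inl (Sum.inr i))
  have hφ : ∀ x i, φ x i = e.repr x (Sum.inl (Sum.inr i)) := fun x i => rfl
  have hsurj : Function.Surjective φ := by
    intro y
    refine ⟨∑ i, y i • e (Sum.inl (Sum.inr i)), ?_⟩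
    funext i
    rw [hφ]
    simp [Finsupp.single_apply]
  have hker : LinearMap.range g = LinearMap.ker φ := by
    ext x
    rw [hg, mem_span_of_repr', LinearMap.mem_ker]
    constructor
    · rintro ⟨h1, -⟩
      funext i
      exact h1 i
    · intro h1
      exact ⟨fun k => congrFun h1 k, fun k => k.elim0⟩
  exact ⟨(Submodule.quotEquivOfEq _ _ hker).trans (φ.quotKerEquivOfSurjective hsurj)⟩

/-- The boundary map out of degree `j`, zero for `j = 0`. -/
def outMap (d : ℕ → ℕ) (D : ∀ j : ℕ, Matrix (Fin (d j)) (Fin (d (j + 1))) (ZMod 2)) :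
    ∀ j : ℕ, (Fin (d j) → ZMod 2) →ₗ[ZMod 2] (Fin (d (j - 1)) → ZMod 2)
  | 0 => 0
  | j + 1 => (D j).mulVecLin

open Module in
theorem range_of_basis {R U V : Type} {ι κ : Type} [CommRing R] [AddCommGroup U] [Module R U]
    [AddCommGroup V] [Module R V] (g : U →ₗ[R] V) (e : Basis (ι ⊕ κ) R U)
    (w : κ → V) (h0 : ∀ i, g (e (Sum.inl i)) = 0) (h1 : ∀ k, g (e (Sum.inr k)) = w k) :
    LinearMap.range g = Submodule.span R (Set.range w) := by
  rw [LinearMap.range_eq_map, ← e.span_eq, Submodule.map_span]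
  apply le_antisymm
  · rw [Submodule.span_le]
    rintro _ ⟨_, ⟨i | k, rfl⟩, rfl⟩
    · rw [h0]; exact Submodule.zero_mem _
    · rw [h1]; exact Submodule.subset_span ⟨k, rfl⟩
  · refine Submodule.span_mono ?_
    rintro _ ⟨k, rfl⟩
    exact ⟨_, ⟨Sum.inr k, rfl⟩, h1 k⟩

/-- Homology of a three-term segment of a chain complex of matrices:
`ker f / im g`, where `f : R^b → R^a` and `g : R^c → R^b` are given by matrices. -/
abbrev homologyAt (R : Type) [CommRing R] {a b c : ℕ}
    (f : Matrix (Fin a) (Fin b) R) (g : Matrix (Fin b) (Fin c) R) :=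
  ↥(LinearMap.ker f.mulVecLin) ⧸
    (LinearMap.range g.mulVecLin).comap (LinearMap.ker f.mulVecLin).subtype

/-- Every chain complex over `F₂` admits an integer lift whose homology groups are
free abelian of ranks equal to the `F₂` Betti numbers (in particular torsion-free). -/
theorem stmt_1 (d : ℕ → ℕ)
    (D : ∀ j : ℕ, Matrix (Fin (d j)) (Fin (d (j + 1))) (ZMod 2))
    (hD : ∀ j, D j * D (j + 1) = 0) :
    ∃ Dt : ∀ j : ℕ, Matrix (Fin (d j)) (Fin (d (j + 1))) ℤ,
      (∀ j i k, ((Dt j i k : ℤ) : ZMod 2) = D j i k) ∧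
      (∀ j, Dt j * Dt (j + 1) = 0) ∧
      (∀ j, Nonempty (homologyAt ℤ (Dt j) (Dt (j + 1)) ≃ₗ[ℤ]
        (Fin (Module.finrank (ZMod 2) (homologyAt (ZMod 2) (D j) (D (j + 1)))) → ℤ))) ∧
      Nonempty (((Fin (d 0) → ℤ) ⧸ LinearMap.range (Dt 0).mulVecLin) ≃ₗ[ℤ]
        (Fin (Module.finrank (ZMod 2)
          ((Fin (d 0) → ZMod 2) ⧸ LinearMap.range (D 0).mulVecLin)) → ℤ)) := by
  let F := outMap d D
  let r : ℕ → ℕ := fun j => Module.finrank (ZMod 2) (LinearMap.range (F j))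
  let v : ∀ j, Module.Basis (Fin (r j)) (ZMod 2) (LinearMap.range (F j)) :=
    fun j => Module.finBasis _ _
  have hFD : ∀ j, F (j + 1) = (D j).mulVecLin := fun j => rfl
  have hr0 : r 0 = 0 := by
    change Module.finrank (ZMod 2) (LinearMap.range
      (0 : (Fin (d 0) → ZMod 2) →ₗ[ZMod 2] (Fin (d (0 - 1)) → ZMod 2))) = 0
    rw [LinearMap.range_zero, finrank_bot]
  have hFF : ∀ j, F j ∘ₗ F (j + 1) = 0 := by
    intro j
    cases j with
    | zero => exact LinearMap.zero_comp _
    | succ j =>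
      change (D j).mulVecLin ∘ₗ (D (j + 1)).mulVecLin = 0
      rw [← Matrix.mulVecLin_mul, hD, Matrix.mulVecLin_zero]
  choose h e he1 he2 he3 using fun j =>
    exists_adapted (F j) (F (j + 1)) (hFF j) (v (j + 1)) (v j)
  choose E hE using fun j => exists_lift_basis (e j)
  let G : ∀ j, (Fin (d (j + 1)) → ℤ) →ₗ[ℤ] (Fin (d j) → ℤ) := fun j =>
    (E (j + 1)).constr ℤ (Sum.elim (fun _ => 0) (fun k => E j (Sum.inl (Sum.inl k))))
  have hG0 : ∀ j i, G j (E (j + 1) (Sum.inl i)) = 0 := fun j i => by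
    simp only [G, Module.Basis.constr_basis, Sum.elim_inl]
  have hG1 : ∀ j k, G j (E (j + 1) (Sum.inr k)) = E j (Sum.inl (Sum.inl k)) := fun j k => by
    simp only [G, Module.Basis.constr_basis, Sum.elim_inr]
  have hGr : ∀ j, LinearMap.range (G j) =
      Submodule.span ℤ (Set.range fun i => E j (Sum.inl (Sum.inl i))) := fun j =>
    range_of_basis (G j) (E (j + 1)) _ (hG0 j) (hG1 j)
  have hFr : ∀ j, LinearMap.range (D j).mulVecLin =
      Submodule.span (ZMod 2) (Set.range fun i => e j (Sum.inl (Sum.inl i))) := fun j =>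
    range_of_basis (F (j + 1)) (e (j + 1)) _ (he2 (j + 1))
      (fun k => (he3 (j + 1) k).trans (he1 j k).symm)
  have hlin : ∀ j, (LinearMap.toMatrix' (G j)).mulVecLin = G j := fun j =>
    Matrix.toLin'_toMatrix' (G j)
  have hmod : ∀ j, (LinearMap.toMatrix' (G j)).map (Int.castRingHom (ZMod 2)) = D j := by
    intro j
    apply Matrix.toLin'.injective
    apply (e (j + 1)).ext
    intro x
    have hx : (e (j + 1) x) = (Int.castRingHom (ZMod 2)) ∘ (E (j + 1) x) := by
      funext k; exact (hE (j + 1) x k).symm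
    have hR : Matrix.toLin' (D j) (e (j + 1) x) =
        (Int.castRingHom (ZMod 2)) ∘ (G j (E (j + 1) x)) := by
      change F (j + 1) (e (j + 1) x) = _
      rcases x with i | k
      · rw [hG0, he2]; funext i; simp
      · rw [hG1, he3, ← he1]; funext i; exact (hE j _ i).symm
    rw [hR, hx]
    funext i
    rw [Matrix.toLin'_apply, ← RingHom.map_mulVec, LinearMap.toMatrix'_mulVec]
    rfl
  refine ⟨fun j => LinearMap.toMatrix' (G j), ?_, ?_, ?_, ?_⟩
  · intro j i k
    exact congrFun (congrFun (hmod j) i) k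
  · intro j
    rw [← LinearMap.toMatrix'_comp]
    have : G j ∘ₗ G (j + 1) = 0 := by
      apply (E (j + 1 + 1)).ext
      rintro (i | k)
      · simp [hG0]
      · simp [hG0, hG1]
    rw [this, map_zero]
  · intro j
    have hF2 : Module.finrank (ZMod 2) (homologyAt (ZMod 2) (D j) (D (j + 1))) = h (j + 1) := by
      obtain ⟨φ⟩ := homology_equiv (D j).mulVecLin (D (j + 1)).mulVecLin (e (j + 1))
        (hFr (j + 1)) (he2 (j + 1)) (by
          have h1 : (fun k => (D j).mulVecLin (e (j + 1) (Sum.inr k))) =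
              fun k => (e j) (Sum.inl (Sum.inl k)) := by
            funext k
            exact (he3 (j + 1) k).trans (he1 j k).symm
          rw [h1]
          exact (e j).linearIndependent.comp _ (Sum.inl_injective.comp Sum.inl_injective))
      rw [φ.finrank_eq, Module.finrank_fin_fun]
    rw [hF2]
    unfold homologyAt
    rw [hlin, hlin]
    refine homology_equiv (G j) (G (j + 1)) (E (j + 1)) (hGr (j + 1)) (hG0 j) ?_
    simp only [hG1]
    exact (E j).linearIndependent.comp _ (Sum.inl_injective.comp Sum.inl_injective)
  · have hF2 : Module.finrank (ZMod 2)
        ((Fin (d 0) → ZMod 2) ⧸ LinearMap.range (D 0).mulVecLin) = h 0 := by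
      obtain ⟨φ⟩ := coker_equiv (D 0).mulVecLin hr0 (e 0) (hFr 0)
      rw [φ.finrank_eq, Module.finrank_fin_fun]
    rw [hF2, hlin]
    exact coker_equiv (G 0) hr0 (E 0) (hGr 0)
end

section
/- Let V be a piecewise smooth singular p-cycle in S^{k−1}, p < k − 1, which bounds a smooth singular (p+1)-chain W in the unit ball B^k. Then V bounds a singular (p+1)-chain W̄ lying entirely in S^{k−1} with (p+1)-area(W̄) ≤ 2^{p+1}(1 + 2π)·(p+1)-area(W). -/
open MeasureTheory ENNReal

/-- A singular `Z/2` `p`-chain in a space `X`: a finitely supported `Z/2`-valued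
function on singular `p`-simplices, i.e. on maps from (the ambient affine space of)
the standard `p`-simplex to `X`. -/
abbrev ZChain (p : ℕ) (X : Type*) := ((Fin (p + 1) → ℝ) → X) →₀ ZMod 2

/-- The boundary of a singular `Z/2` `(p+1)`-chain: the sum of the faces, obtained
by precomposing each simplex with the affine face embeddings `Fin.insertNth i 0`. -/
noncomputable def chainBd {p : ℕ} {X : Type*} (c : ZChain (p + 1) X) : ZChain p X :=
  c.sum fun τ a =>
    a • ∑ i : Fin (p + 2), Finsupp.single (fun x => τ (i.insertNth 0 x)) (1 : ZMod 2)

/-- The (unsigned) mass of a `Z/2` `p`-chain in Euclidean space: the sum over the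
simplices in its support of the `p`-dimensional Hausdorff measure of their images. -/
noncomputable def chainMass {p k : ℕ} (c : ZChain p (EuclideanSpace ℝ (Fin k))) :
    ENNReal :=
  ∑ τ ∈ c.support, μH[(p : ℝ)] (τ '' stdSimplex ℝ (Fin (p + 1)))

/-- The chain `c` is carried by the set `A`. -/
def chainIn {p : ℕ} {X : Type*} (c : ZChain p X) (A : Set X) : Prop :=
  ∀ τ ∈ c.support, τ '' stdSimplex ℝ (Fin (p + 1)) ⊆ A


/-! ### Part 1: the natural extension operator -/

noncomputable def pLam {n : ℕ} (x : Fin n → ℝ) : ℝ := ∑ i, max (x i) 0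

noncomputable def pRho {n : ℕ} (x : Fin n → ℝ) : Fin n → ℝ := fun i => max (x i) 0 / pLam x

lemma pLam_nonneg {n : ℕ} (x : Fin n → ℝ) : 0 ≤ pLam x :=
  Finset.sum_nonneg fun _ _ => le_max_right _ _

lemma pLam_continuous {n : ℕ} : Continuous (pLam : (Fin n → ℝ) → ℝ) := by
  unfold pLam; fun_prop

lemma pLam_ins {n : ℕ} (i : Fin (n + 1)) (x : Fin n → ℝ) :
    pLam (i.insertNth (0 : ℝ) x : Fin (n + 1) → ℝ) = pLam x := by
  unfold pLam
  rw [Fin.sum_univ_succAbove _ i]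
  simp

lemma pRho_ins {n : ℕ} (i : Fin (n + 1)) (x : Fin n → ℝ) :
    pRho (i.insertNth (0 : ℝ) x : Fin (n + 1) → ℝ) = i.insertNth (0 : ℝ) (pRho x) := by
  ext j
  refine Fin.succAboveCases i ?_ (fun j => ?_) j
  · simp [pRho]
  · simp [pRho, pLam_ins]

lemma pRho_mem {n : ℕ} (x : Fin n → ℝ) (hx : 0 < pLam x) : pRho x ∈ stdSimplex ℝ (Fin n) := by
  refine ⟨fun i => div_nonneg (le_max_right _ _) hx.le, ?_⟩
  simp only [pRho]
  rw [← Finset.sum_div]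
  exact div_self hx.ne'

lemma pLam_simplex {n : ℕ} {x : Fin n → ℝ} (hx : x ∈ stdSimplex ℝ (Fin n)) : pLam x = 1 := by
  rw [← hx.2]
  exact Finset.sum_congr rfl fun i _ => max_eq_left (hx.1 i)

lemma pRho_simplex {n : ℕ} {x : Fin n → ℝ} (hx : x ∈ stdSimplex ℝ (Fin n)) : pRho x = x := by
  ext i
  simp [pRho, pLam_simplex hx, max_eq_left (hx.1 i)]

lemma ins_mem_simplex {n : ℕ} (i : Fin (n + 1)) {x : Fin n → ℝ}
    (hx : x ∈ stdSimplex ℝ (Fin n)) :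
    (i.insertNth (0 : ℝ) x : Fin (n + 1) → ℝ) ∈ stdSimplex ℝ (Fin (n + 1)) := by
  refine ⟨fun j => ?_, ?_⟩
  · refine Fin.succAboveCases i ?_ (fun j => ?_) j
    · simp
    · simpa using hx.1 j
  · rw [Fin.sum_univ_succAbove _ i]
    simpa using hx.2

section
variable {E : Type*} [NormedAddCommGroup E] [NormedSpace ℝ E]

noncomputable def pExt {n : ℕ} (D : ((Fin n → ℝ) → E) → ((Fin n → ℝ) → E))
    (τ : (Fin n → ℝ) → E) : (Fin n → ℝ) → E :=
  fun x => τ x + min 1 (pLam x) • (D τ (pRho x) - τ (pRho x))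

lemma pExt_simplex {n : ℕ} (D : ((Fin n → ℝ) → E) → ((Fin n → ℝ) → E))
    (τ : (Fin n → ℝ) → E) {x : Fin n → ℝ} (hx : x ∈ stdSimplex ℝ (Fin n)) :
    pExt D τ x = D τ x := by
  simp [pExt, pLam_simplex hx, pRho_simplex hx]

lemma pExt_eq_self {n : ℕ} (D : ((Fin n → ℝ) → E) → ((Fin n → ℝ) → E))
    (τ : (Fin n → ℝ) → E) (h : ∀ x ∈ stdSimplex ℝ (Fin n), D τ x = τ x) :
    pExt D τ = τ := by
  ext x
  rcases (pLam_nonneg x).eq_or_lt with h0 | h0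
  · simp [pExt, ← h0]
  · simp [pExt, h _ (pRho_mem x h0)]

lemma pExt_continuous {n : ℕ} (D : ((Fin n → ℝ) → E) → ((Fin n → ℝ) → E))
    (τ : (Fin n → ℝ) → E) (hτ : Continuous τ)
    (hD : ContinuousOn (D τ) (stdSimplex ℝ (Fin n))) : Continuous (pExt D τ) := by
  unfold pExt
  refine hτ.add ?_
  have hf : ContinuousOn (fun y => D τ y - τ y) (stdSimplex ℝ (Fin n)) :=
    hD.sub hτ.continuousOn
  obtain ⟨C, hC⟩ := (isCompact_stdSimplex ℝ (Fin n)).exists_bound_of_continuousOn hf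
  rw [continuous_iff_continuousAt]
  intro x
  rcases (pLam_nonneg x).eq_or_lt with h0 | h0
  · have hb : ∀ y : Fin n → ℝ,
        ‖min 1 (pLam y) • (D τ (pRho y) - τ (pRho y))‖ ≤ min 1 (pLam y) * C := by
      intro y
      have hm : 0 ≤ min 1 (pLam y) := le_min zero_le_one (pLam_nonneg y)
      rcases (pLam_nonneg y).eq_or_lt with h1 | h1
      · simp [← h1]
      · rw [norm_smul, Real.norm_of_nonneg hm]
        exact mul_le_mul_of_nonneg_left (hC _ (pRho_mem y h1)) hm
    have h2 : min 1 (pLam x) • (D τ (pRho x) - τ (pRho x)) = 0 := by simp [← h0]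
    show Filter.Tendsto _ _ (nhds (min 1 (pLam x) • (D τ (pRho x) - τ (pRho x))))
    rw [h2]
    refine squeeze_zero_norm hb ?_
    have : Continuous fun y : Fin n → ℝ => min 1 (pLam y) * C :=
      (continuous_const.min pLam_continuous).mul continuous_const
    have h3 := this.tendsto x
    simpa [← h0] using h3
  · have hopen : IsOpen {y : Fin n → ℝ | 0 < pLam y} :=
      isOpen_lt continuous_const pLam_continuous
    have hr : ContinuousOn (pRho : (Fin n → ℝ) → (Fin n → ℝ)) {y | 0 < pLam y} := by
      rw [continuousOn_pi]
      intro i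
      unfold pRho
      refine ContinuousOn.div (by fun_prop) pLam_continuous.continuousOn ?_
      intro y hy
      exact (ne_of_gt hy)
    have hc : ContinuousOn (fun y => min 1 (pLam y) • (D τ (pRho y) - τ (pRho y)))
        {y | 0 < pLam y} := by
      refine ContinuousOn.smul (continuous_const.min pLam_continuous).continuousOn ?_
      exact hf.comp hr fun y hy => pRho_mem y hy
    exact hc.continuousAt (hopen.mem_nhds h0)

end

lemma chainBd_mapDomain {p : ℕ} {X : Type*} (T0 : ((Fin (p + 1) → ℝ) → X) → ((Fin (p + 1) → ℝ) → X))
    (T1 : ((Fin (p + 2) → ℝ) → X) → ((Fin (p + 2) → ℝ) → X))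
    (hT : ∀ τ (i : Fin (p + 2)), (fun x => T1 τ (i.insertNth (0 : ℝ) x)) =
      T0 (fun x => τ (i.insertNth (0 : ℝ) x))) (W : ZChain (p + 1) X) :
    chainBd (p := p) (Finsupp.mapDomain T1 W) = Finsupp.mapDomain T0 (chainBd (p := p) W) := by
  unfold chainBd
  rw [Finsupp.sum_mapDomain_index (by simp) (by intros; rw [add_smul]), Finsupp.sum,
    Finsupp.sum, Finsupp.mapDomain_finsetSum]
  refine Finset.sum_congr rfl fun τ _ => ?_
  rw [Finsupp.mapDomain_smul, Finsupp.mapDomain_finsetSum]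
  congr 1
  refine Finset.sum_congr rfl fun i _ => ?_
  rw [Finsupp.mapDomain_single, hT]

lemma push_chain {k p : ℕ}
    (V : ZChain p (EuclideanSpace ℝ (Fin k)))
    (W : ZChain (p + 1) (EuclideanSpace ℝ (Fin k)))
    (hWcont : ∀ τ ∈ W.support, Continuous τ)
    (hbd : chainBd W = V)
    (D0 : ((Fin (p + 1) → ℝ) → EuclideanSpace ℝ (Fin k)) → ((Fin (p + 1) → ℝ) → EuclideanSpace ℝ (Fin k)))
    (D1 : ((Fin (p + 2) → ℝ) → EuclideanSpace ℝ (Fin k)) → ((Fin (p + 2) → ℝ) → EuclideanSpace ℝ (Fin k)))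
    (hnat : ∀ τ (i : Fin (p + 2)), ∀ y ∈ stdSimplex ℝ (Fin (p + 1)),
      D1 τ (i.insertNth (0 : ℝ) y) = D0 (fun x => τ (i.insertNth (0 : ℝ) x)) y)
    (hcont : ∀ τ ∈ W.support, ContinuousOn (D1 τ) (stdSimplex ℝ (Fin (p + 2))))
    (hV : ∀ σ ∈ V.support, ∀ y ∈ stdSimplex ℝ (Fin (p + 1)), D0 σ y = σ y)
    (hS : ∀ τ ∈ W.support, D1 τ '' (stdSimplex ℝ (Fin (p + 2))) ⊆ Metric.sphere 0 1) :
    ∃ W' : ZChain (p + 1) (EuclideanSpace ℝ (Fin k)),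
      (∀ τ ∈ W'.support, Continuous τ) ∧
      chainIn W' (Metric.sphere 0 1) ∧
      chainBd W' = V ∧
      chainMass W' ≤
        ∑ τ ∈ W.support, μH[((p + 1 : ℕ) : ℝ)] (D1 τ '' stdSimplex ℝ (Fin (p + 2))) := by
  classical
  have himg : ∀ τ, pExt D1 τ '' stdSimplex ℝ (Fin (p + 2)) = D1 τ '' stdSimplex ℝ (Fin (p + 2)) :=
    fun τ => Set.image_congr fun x hx => pExt_simplex D1 τ hx
  have hmem : ∀ τ' ∈ (Finsupp.mapDomain (pExt D1) W).support, ∃ τ ∈ W.support, pExt D1 τ = τ' := by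
    intro τ' h
    simpa using Finsupp.mapDomain_support h
  refine ⟨Finsupp.mapDomain (pExt D1) W, ?_, ?_, ?_, ?_⟩
  · intro τ' h
    obtain ⟨τ, hτ, rfl⟩ := hmem τ' h
    exact pExt_continuous D1 τ (hWcont τ hτ) (hcont τ hτ)
  · intro τ' h
    obtain ⟨τ, hτ, rfl⟩ := hmem τ' h
    rw [himg]
    exact hS τ hτ
  · rw [chainBd_mapDomain (pExt D0) (pExt D1), hbd]
    · have : Finsupp.mapDomain (pExt D0) V = Finsupp.mapDomain id V :=
        Finsupp.mapDomain_congr fun σ hσ => pExt_eq_self D0 σ (hV σ hσ)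
      rw [this, Finsupp.mapDomain_id]
    · intro τ i
      ext1 x
      simp only [pExt, pLam_ins, pRho_ins]
      rcases (pLam_nonneg x).eq_or_lt with h0 | h0
      · simp [← h0]
      · rw [hnat _ _ _ (pRho_mem x h0)]
  · unfold chainMass
    calc _ ≤ ∑ τ' ∈ W.support.image (pExt D1),
          μH[((p + 1 : ℕ) : ℝ)] (τ' '' stdSimplex ℝ (Fin (p + 2))) :=
          Finset.sum_le_sum_of_subset Finsupp.mapDomain_support
      _ ≤ ∑ τ ∈ W.support, μH[((p + 1 : ℕ) : ℝ)] (pExt D1 τ '' stdSimplex ℝ (Fin (p + 2))) :=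
          Finset.sum_image_le_of_nonneg (fun _ _ => zero_le)
      _ = _ := by simp only [himg]

/-! ### Part 2: radial projection from an interior point -/

section Geometry
variable {E : Type*} [NormedAddCommGroup E] [InnerProductSpace ℝ E]

/-- unit direction from `a` to `z` -/
noncomputable def gU (a z : E) : E := ‖z - a‖⁻¹ • (z - a)

/-- half chord length -/
noncomputable def gH (a z : E) : ℝ := √(1 - ‖a‖ ^ 2 + (inner ℝ a (gU a z)) ^ 2)

/-- distance from `a` to the sphere in the direction of `z` -/
noncomputable def gT (a z : E) : ℝ := gH a z - inner ℝ a (gU a z)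

/-- the radial projection from `a` to the unit sphere -/
noncomputable def gP (a z : E) : E := a + gT a z • gU a z

/-- the local Lipschitz constant -/
noncomputable def gG (a z : E) : ℝ := gT a z / (gH a z * ‖z - a‖)

lemma gU_norm {a z : E} (h : z ≠ a) : ‖gU a z‖ = 1 := by
  have : ‖z - a‖ ≠ 0 := by simpa [sub_eq_zero] using h
  rw [gU, norm_smul, norm_inv, norm_norm, inv_mul_cancel₀ this]

lemma gH_sq {a : E} (z : E) (ha : ‖a‖ < 1) :
    gH a z ^ 2 = 1 - ‖a‖ ^ 2 + (inner ℝ a (gU a z)) ^ 2 := by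
  apply Real.sq_sqrt
  have : ‖a‖ ^ 2 < 1 := by nlinarith [norm_nonneg a]
  positivity [sub_pos.2 this]

lemma gH_pos {a : E} (z : E) (ha : ‖a‖ < 1) : 0 < gH a z := by
  apply Real.sqrt_pos.2
  have : ‖a‖ ^ 2 < 1 := by nlinarith [norm_nonneg a]
  have := sq_nonneg (inner ℝ a (gU a z))
  linarith

lemma gT_pos {a : E} (z : E) (ha : ‖a‖ < 1) : 0 < gT a z := by
  have h1 := gH_sq z ha
  have h2 := gH_pos z ha
  have : ‖a‖ ^ 2 < 1 := by nlinarith [norm_nonneg a]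
  unfold gT
  nlinarith

lemma gG_pos {a z : E} (ha : ‖a‖ < 1) (h : z ≠ a) : 0 < gG a z := by
  have : 0 < ‖z - a‖ := by simpa [sub_eq_zero] using h
  have := gH_pos z ha
  have := gT_pos z ha
  unfold gG
  positivity

lemma gP_norm {a z : E} (ha : ‖a‖ < 1) (h : z ≠ a) : ‖gP a z‖ = 1 := by
  have h1 := gH_sq z ha
  have h2 : ‖gP a z‖ ^ 2 = 1 := by
    rw [gP, norm_add_sq_real, norm_smul, gU_norm h, inner_smul_right, mul_one, Real.norm_eq_abs,
      sq_abs]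
    unfold gT
    nlinarith
  have := norm_nonneg (gP a z)
  nlinarith

lemma gP_sphere {a z : E} (ha : ‖a‖ < 1) (hz : ‖z‖ = 1) : gP a z = z := by
  have hne : z ≠ a := by rintro rfl; linarith
  have hr : 0 < ‖z - a‖ := by simpa [sub_eq_zero] using hne
  have hzu : z = a + ‖z - a‖ • gU a z := by
    rw [gU, smul_smul, mul_inv_cancel₀ hr.ne', one_smul]; abel
  have hz2 : ‖z‖ ^ 2 = ‖a‖ ^ 2 + 2 * (‖z - a‖ * inner ℝ a (gU a z)) + ‖z - a‖ ^ 2 := by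
    conv_lhs => rw [hzu]
    rw [norm_add_sq_real, norm_smul, gU_norm hne, inner_smul_right]
    simp
  have h1 := gH_sq z ha
  have h2 := gH_pos z ha
  have h3 := gT_pos z ha
  have key : (gT a z - ‖z - a‖) * (gT a z + ‖z - a‖ + 2 * inner ℝ a (gU a z)) = 0 := by
    have : gH a z = gT a z + inner ℝ a (gU a z) := by unfold gT; ring
    rw [this] at h1
    rw [hz] at hz2
    nlinarith
  have ha2 : ‖a‖ ^ 2 < 1 := by nlinarith [norm_nonneg a]
  have hne2 : gT a z + ‖z - a‖ + 2 * inner ℝ a (gU a z) ≠ 0 := by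
    have : 0 < gH a z + inner ℝ a (gU a z) := by nlinarith
    unfold gT
    intro h
    linarith
  have := (mul_eq_zero.1 key).resolve_right hne2
  rw [gP, sub_eq_zero.1 this]
  exact hzu.symm

lemma gU_cont {a z : E} (h : z ≠ a) : ContinuousAt (gU a) z := by
  have : ‖z - a‖ ≠ 0 := by simpa [sub_eq_zero] using h
  unfold gU
  fun_prop (disch := assumption)

lemma gH_cont {a z : E} (h : z ≠ a) : ContinuousAt (gH a) z := by
  have := gU_cont h
  unfold gH
  fun_prop

lemma gT_cont {a z : E} (h : z ≠ a) : ContinuousAt (gT a) z := by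
  have := gU_cont h
  have := gH_cont h
  unfold gT
  fun_prop

lemma gP_cont {a z : E} (h : z ≠ a) : ContinuousAt (gP a) z := by
  have := gU_cont h
  have := gT_cont h
  unfold gP
  fun_prop

lemma gG_cont {a z : E} (ha : ‖a‖ < 1) (h : z ≠ a) : ContinuousAt (gG a) z := by
  have := gH_cont h
  have := gT_cont h
  have h0 : ‖z - a‖ ≠ 0 := by simpa [sub_eq_zero] using h
  have h1 : gH a z * ‖z - a‖ ≠ 0 := mul_ne_zero (gH_pos z ha).ne' h0
  unfold gG
  fun_prop (disch := assumption)

lemma bessel_two (a e w : E) (h : inner ℝ e w = 0) :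
    (inner ℝ a e) ^ 2 * ‖w‖ ^ 2 + (inner ℝ a w) ^ 2 * ‖e‖ ^ 2 ≤ ‖a‖ ^ 2 * (‖e‖ ^ 2 * ‖w‖ ^ 2) := by
  by_cases he : e = 0
  · simp [he]
  by_cases hw : w = 0
  · simp [hw]
  have he' : 0 < ‖e‖ := norm_pos_iff.2 he
  have hw' : 0 < ‖w‖ := norm_pos_iff.2 hw
  have h' : inner ℝ w e = 0 := by rw [real_inner_comm]; exact h
  have h0 : 0 ≤ ‖(‖e‖ ^ 2 * ‖w‖ ^ 2) • a - (inner ℝ a e * ‖w‖ ^ 2) • e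
      - (inner ℝ a w * ‖e‖ ^ 2) • w‖ ^ 2 := sq_nonneg _
  have h1 : ‖(‖e‖ ^ 2 * ‖w‖ ^ 2) • a - (inner ℝ a e * ‖w‖ ^ 2) • e
      - (inner ℝ a w * ‖e‖ ^ 2) • w‖ ^ 2 = (‖e‖ ^ 2 * ‖w‖ ^ 2) * (‖a‖ ^ 2 * (‖e‖ ^ 2 * ‖w‖ ^ 2)
        - ((inner ℝ a e) ^ 2 * ‖w‖ ^ 2 + (inner ℝ a w) ^ 2 * ‖e‖ ^ 2)) := by
    rw [← real_inner_self_eq_norm_sq]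
    simp only [inner_sub_left, inner_sub_right, inner_smul_left, inner_smul_right, h, h',
      real_inner_self_eq_norm_sq, real_inner_comm a e, real_inner_comm a w]
    simp
    ring
  rw [h1] at h0
  have h2 : 0 < ‖e‖ ^ 2 * ‖w‖ ^ 2 := by positivity
  have := nonneg_of_mul_nonneg_right h0 h2
  linarith

/-- the two-point comparison constant (squared) -/
noncomputable def gM (a z z' : E) : ℝ :=
  gT a z * gT a z' + (‖a‖ ^ 2 - (inner ℝ a (gU a z + gU a z')) ^ 2 / ‖gU a z + gU a z'‖ ^ 2)
    * ((gT a z + gT a z') / (gH a z + gH a z')) ^ 2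

lemma gP_two {a z z' : E} (ha : ‖a‖ < 1) (h : z ≠ a) (h' : z' ≠ a)
    (hw : gU a z + gU a z' ≠ 0) :
    ‖gP a z - gP a z'‖ ^ 2 ≤ gM a z z' / (‖z - a‖ * ‖z' - a‖) * ‖z - z'‖ ^ 2 := by
  have hr : 0 < ‖z - a‖ := by simpa [sub_eq_zero] using h
  have hr' : 0 < ‖z' - a‖ := by simpa [sub_eq_zero] using h'
  have hu := gU_norm h
  have hu' := gU_norm h'
  have hH := gH_sq z ha
  have hH' := gH_sq z' ha
  have hp := gH_pos z ha
  have hp' := gH_pos z' ha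
  have hz : z - z' = ‖z - a‖ • gU a z - ‖z' - a‖ • gU a z' := by
    simp only [gU]
    rw [smul_smul, smul_smul, mul_inv_cancel₀ hr.ne', mul_inv_cancel₀ hr'.ne', one_smul, one_smul]
    abel
  have hP : gP a z - gP a z' = gT a z • gU a z - gT a z' • gU a z' := by
    simp only [gP]; abel
  have hT : gT a z = gH a z - inner ℝ a (gU a z) := rfl
  have hT' : gT a z' = gH a z' - inner ℝ a (gU a z') := rfl
  have hTp := gT_pos z ha
  have hTp' := gT_pos z' ha
  have hM : gM a z z' = gT a z * gT a z' +
    (‖a‖ ^ 2 - (inner ℝ a (gU a z + gU a z')) ^ 2 / ‖gU a z + gU a z'‖ ^ 2)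
    * ((gT a z + gT a z') / (gH a z + gH a z')) ^ 2 := rfl
  rw [hz, hP]
  generalize gU a z = u at *
  generalize gU a z' = u' at *
  generalize gT a z = t at *
  generalize gT a z' = t' at *
  generalize gH a z = b at *
  generalize gH a z' = b' at *
  generalize ‖z - a‖ = r at *
  generalize ‖z' - a‖ = r' at *
  have gen : ∀ s s' : ℝ, ‖s • u - s' • u'‖ ^ 2 = (s - s') ^ 2 + s * s' * ‖u - u'‖ ^ 2 := by
    intro s s'
    rw [norm_sub_sq_real, norm_sub_sq_real u u', norm_smul, norm_smul, hu, hu', inner_smul_left,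
      inner_smul_right]
    simp
    ring
  rw [gen, gen]
  have horth : inner ℝ (u - u') (u + u') = 0 := by
    rw [inner_sub_left, inner_add_right, inner_add_right, real_inner_self_eq_norm_sq,
      real_inner_self_eq_norm_sq, hu, hu', real_inner_comm u u']
    ring
  have hb := bessel_two a (u - u') (u + u') horth
  have hw2 : 0 < ‖u + u'‖ ^ 2 := by positivity
  have hb2 : (inner ℝ a (u - u')) ^ 2 ≤
      (‖a‖ ^ 2 - (inner ℝ a (u + u')) ^ 2 / ‖u + u'‖ ^ 2) * ‖u - u'‖ ^ 2 := by
    rw [← mul_le_mul_iff_left₀ hw2]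
    calc _ ≤ ‖a‖ ^ 2 * (‖u - u'‖ ^ 2 * ‖u + u'‖ ^ 2) - (inner ℝ a (u + u')) ^ 2 * ‖u - u'‖ ^ 2 := by
          linarith
      _ = _ := by field_simp
  have htt : t - t' = - inner ℝ a (u - u') * ((t + t') / (b + b')) := by
    rw [inner_sub_right, mul_div_assoc', _root_.eq_div_iff (by positivity)]
    rw [hT, hT']
    linear_combination hH - hH'
  have hMn : (t - t') ^ 2 + t * t' * ‖u - u'‖ ^ 2 ≤ gM a z z' * ‖u - u'‖ ^ 2 := by
    rw [htt, hM]
    have := mul_le_mul_of_nonneg_right hb2 (sq_nonneg ((t + t') / (b + b')))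
    nlinarith
  have hM0 : 0 ≤ gM a z z' := by
    by_contra hneg
    by_cases hd : ‖u - u'‖ ^ 2 = 0
    · have h0 : u = u' := by simpa [sub_eq_zero] using hd
      have h1 : (inner ℝ a (u + u')) ^ 2 / ‖u + u'‖ ^ 2 ≤ ‖a‖ ^ 2 := by
        rw [div_le_iff₀ hw2, ← mul_pow]
        exact sq_le_sq' (neg_le_of_abs_le (abs_real_inner_le_norm _ _)) (real_inner_le_norm _ _)
      have : 0 ≤ gM a z z' := by
        rw [hM]
        have := sub_nonneg.2 h1
        positivity
      exact hneg this
    · have hd' : 0 < ‖u - u'‖ ^ 2 := lt_of_le_of_ne (sq_nonneg _) (Ne.symm hd)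
      have : 0 ≤ (t - t') ^ 2 + t * t' * ‖u - u'‖ ^ 2 := by positivity
      nlinarith
  calc _ ≤ gM a z z' * ‖u - u'‖ ^ 2 := hMn
    _ = gM a z z' / (r * r') * (r * r' * ‖u - u'‖ ^ 2) := by field_simp
    _ ≤ _ := by
        apply mul_le_mul_of_nonneg_left _ (by positivity)
        nlinarith [sq_nonneg (r - r')]

lemma gM_diag {a z : E} (ha : ‖a‖ < 1) (h : z ≠ a) :
    gM a z z / (‖z - a‖ * ‖z - a‖) = gG a z ^ 2 := by
  have hr : 0 < ‖z - a‖ := by simpa [sub_eq_zero] using h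
  have hu := gU_norm h
  have hH := gH_sq z ha
  have hp := gH_pos z ha
  have e1 : inner ℝ a (gU a z + gU a z) = 2 * inner ℝ a (gU a z) := by
    rw [inner_add_right]; ring
  have e2 : ‖gU a z + gU a z‖ ^ 2 = 4 := by
    rw [← two_smul ℝ, norm_smul, hu]; norm_num
  unfold gM gG
  rw [e1, e2]
  have e3 : (gT a z + gT a z) / (gH a z + gH a z) = gT a z / gH a z := by
    field_simp
  rw [e3]
  have e4 : ‖a‖ ^ 2 - (2 * inner ℝ a (gU a z)) ^ 2 / 4 = 1 - gH a z ^ 2 := by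
    rw [hH]; ring
  rw [e4]
  field_simp
  ring

lemma gP_local_lip {a x : E} (ha : ‖a‖ < 1) (h : x ≠ a) {q : ℝ} (hq : 1 < q) :
    ∃ U : Set E, IsOpen U ∧ x ∈ U ∧ ∀ z ∈ U, ∀ z' ∈ U,
      ‖gP a z - gP a z'‖ ≤ q * gG a x * ‖z - z'‖ := by
  have hG := gG_pos ha h
  have hr : 0 < ‖x - a‖ := by simpa [sub_eq_zero] using h
  have c1 : ContinuousAt (fun w : E × E => gU a w.1) (x, x) :=
    ContinuousAt.comp (f := Prod.fst) (gU_cont h) continuousAt_fst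
  have c2 : ContinuousAt (fun w : E × E => gU a w.2) (x, x) :=
    ContinuousAt.comp (f := Prod.snd) (gU_cont h) continuousAt_snd
  have c3 : ContinuousAt (fun w : E × E => gT a w.1) (x, x) :=
    ContinuousAt.comp (f := Prod.fst) (gT_cont h) continuousAt_fst
  have c4 : ContinuousAt (fun w : E × E => gT a w.2) (x, x) :=
    ContinuousAt.comp (f := Prod.snd) (gT_cont h) continuousAt_snd
  have c5 : ContinuousAt (fun w : E × E => gH a w.1) (x, x) :=
    ContinuousAt.comp (f := Prod.fst) (gH_cont h) continuousAt_fst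
  have c6 : ContinuousAt (fun w : E × E => gH a w.2) (x, x) :=
    ContinuousAt.comp (f := Prod.snd) (gH_cont h) continuousAt_snd
  have hw0 : gU a x + gU a x ≠ 0 := by
    rw [← two_smul ℝ, smul_ne_zero_iff]
    refine ⟨by norm_num, fun h0 => ?_⟩
    have := gU_norm h
    rw [h0] at this
    simp at this
  have n1 : ‖gU a x + gU a x‖ ^ 2 ≠ 0 := by positivity
  have n2 : gH a x + gH a x ≠ 0 := by
    have := gH_pos x ha
    positivity
  have n3 : ‖x - a‖ * ‖x - a‖ ≠ 0 := by positivity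
  have cM : ContinuousAt (fun w : E × E => gM a w.1 w.2 / (‖w.1 - a‖ * ‖w.2 - a‖)) (x, x) := by
    unfold gM
    fun_prop (disch := assumption)
  have ev1 : ∀ᶠ w : E × E in nhds (x, x),
      gM a w.1 w.2 / (‖w.1 - a‖ * ‖w.2 - a‖) < (q * gG a x) ^ 2 := by
    apply cM.eventually_lt_const
    show gM a x x / (‖x - a‖ * ‖x - a‖) < _
    rw [gM_diag ha h, mul_pow]
    have : 0 < gG a x ^ 2 := by positivity
    have hq2 : 1 < q ^ 2 := by nlinarith
    nlinarith
  have ev2 : ∀ᶠ w : E × E in nhds (x, x), gU a w.1 + gU a w.2 ≠ 0 :=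
    (c1.add c2).eventually_ne hw0
  have ev3 : ∀ᶠ w : E × E in nhds (x, x), w.1 ≠ a :=
    continuousAt_fst.eventually_ne h
  have ev4 : ∀ᶠ w : E × E in nhds (x, x), w.2 ≠ a :=
    continuousAt_snd.eventually_ne h
  have ev := ev1.and (ev2.and (ev3.and ev4))
  rw [nhds_prod_eq, Filter.eventually_iff, Filter.mem_prod_same_iff] at ev
  obtain ⟨t, ht, hev⟩ := ev
  obtain ⟨U, hUt, hUo, hxU⟩ := mem_nhds_iff.1 ht
  refine ⟨U, hUo, hxU, fun z hz z' hz' => ?_⟩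
  obtain ⟨h1, h2, h3, h4⟩ := hev (Set.mk_mem_prod (hUt hz) (hUt hz'))
  have h5 := gP_two ha h3 h4 h2
  have h6 : ‖gP a z - gP a z'‖ ^ 2 ≤ (q * gG a x * ‖z - z'‖) ^ 2 := by
    rw [mul_pow]
    exact h5.trans (mul_le_mul_of_nonneg_right h1.le (sq_nonneg _))
  exact (pow_le_pow_iff_left₀ (norm_nonneg _) (by positivity) two_ne_zero).1 h6

end Geometry

/-! ### Part 3: Hausdorff measure of the projected set -/

section Haus
variable {E : Type*} [NormedAddCommGroup E] [InnerProductSpace ℝ E] [MeasurableSpace E]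
  [BorelSpace E]

lemma gP_hausdorff {a : E} (ha : ‖a‖ < 1) {K : Set E} (hK : IsCompact K) (haK : a ∉ K) {q : ℝ}
    (hq : 1 < q) (m : ℕ) :
    μH[(m : ℝ)] (gP a '' K) ≤
      ENNReal.ofReal (q ^ 2) ^ m * ∫⁻ x in K, ENNReal.ofReal (gG a x) ^ m ∂μH[(m : ℝ)] := by
  have hne : ∀ x ∈ K, x ≠ a := fun x hx h => haK (h ▸ hx)
  have hloc : ∀ x : K, ∃ U : Set E, IsOpen U ∧ (x : E) ∈ U ∧ (∀ z ∈ U, ∀ z' ∈ U,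
      ‖gP a z - gP a z'‖ ≤ q * gG a x * ‖z - z'‖) ∧ ∀ z ∈ U, gG a x ≤ q * gG a z := by
    intro x
    obtain ⟨U, hU, hxU, hl⟩ := gP_local_lip ha (hne x x.2) hq
    have hG := gG_pos ha (hne x x.2)
    have hc : ∀ᶠ z in nhds (x : E), gG a x / q < gG a z :=
      (gG_cont ha (hne x x.2)).eventually_const_lt (div_lt_self hG hq)
    obtain ⟨U', hU't, hU'o, hxU'⟩ := mem_nhds_iff.1 hc
    refine ⟨U ∩ U', hU.inter hU'o, ⟨hxU, hxU'⟩, fun z hz z' hz' => hl z hz.1 z' hz'.1,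
      fun z hz => ?_⟩
    have := hU't hz.2
    have h2 : gG a x / q < gG a z := this
    rw [div_lt_iff₀ (by linarith)] at h2
    linarith
  choose U hUo hxU hUl hUg using hloc
  obtain ⟨t, ht⟩ := hK.elim_finite_subcover U hUo (fun x hx => Set.mem_iUnion.2 ⟨⟨x, hx⟩, hxU _⟩)
  set ν : Set E → ENNReal := fun A =>
    ENNReal.ofReal (q ^ 2) ^ m * ∫⁻ x in A, ENNReal.ofReal (gG a x) ^ m ∂μH[(m : ℝ)] with hν
  have key : ∀ (t : Finset K) (A : Set E), MeasurableSet A → A ⊆ K → A ⊆ (⋃ i ∈ t, U i) →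
      μH[(m : ℝ)] (gP a '' A) ≤ ν A := by
    classical
    intro t
    induction t using Finset.induction_on with
    | empty =>
      intro A _ _ hA
      have : A = ∅ := by simpa using hA
      simp [this]
    | insert x t hxt ih =>
      intro A hAm hAK hA
      have h1 : μH[(m : ℝ)] (gP a '' (A ∩ U x)) ≤ ν (A ∩ U x) := by
        have hG := gG_pos ha (hne x x.2)
        have hlip : LipschitzOnWith (q * gG a x).toNNReal (gP a) (A ∩ U x) := by
          apply LipschitzOnWith.of_dist_le_mul
          intro z hz z' hz'
          rw [dist_eq_norm, dist_eq_norm, Real.coe_toNNReal _ (by positivity)]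
          exact hUl x z hz.2 z' hz'.2
        refine (hlip.hausdorffMeasure_image_le (Nat.cast_nonneg m)).trans ?_
        rw [hν]
        simp only
        rw [← lintegral_const_mul' _ _ (by simp), ← setLIntegral_const]
        refine setLIntegral_mono' (hAm.inter (hUo x).measurableSet) ?_
        intro z hz
        rw [ENNReal.rpow_natCast, ← mul_pow, ← ENNReal.ofReal_mul (by positivity)]
        refine pow_le_pow_left' ?_ _
        refine ENNReal.ofReal_le_ofReal ?_
        have := hUg x z hz.2
        nlinarith
      have h2 : μH[(m : ℝ)] (gP a '' (A \ U x)) ≤ ν (A \ U x) := by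
        refine ih _ (hAm.diff (hUo x).measurableSet) (Set.sdiff_subset.trans hAK) ?_
        rintro z ⟨hz, hz'⟩
        have := hA hz
        simp only [Finset.mem_insert, Set.mem_iUnion, exists_prop] at this ⊢
        obtain ⟨i, rfl | hi, hzi⟩ := this
        · exact absurd hzi hz'
        · exact ⟨i, hi, hzi⟩
      calc μH[(m : ℝ)] (gP a '' A)
          = μH[(m : ℝ)] (gP a '' (A ∩ U x) ∪ gP a '' (A \ U x)) := by
            rw [← Set.image_union, Set.inter_union_sdiff]
        _ ≤ _ := measure_union_le _ _
        _ ≤ ν (A ∩ U x) + ν (A \ U x) := add_le_add h1 h2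
        _ = ν A := by
            simp only [hν]
            rw [← mul_add, lintegral_inter_add_sdiff _ _ (hUo x).measurableSet]
  exact key t K hK.measurableSet subset_rfl ht

end Haus

/-! ### Part 4: averaging over the centre of projection -/

lemma lint_pow (n : ℕ) (hn : 0 < n) {R : ℝ} (hR : 0 ≤ R) :
    ∫⁻ r in Set.Ioo 0 R, ENNReal.ofReal (r ^ (n - 1)) = ENNReal.ofReal (R ^ n / n) := by
  rw [← ofReal_integral_eq_lintegral_ofReal]
  · rw [← integral_Ioc_eq_integral_Ioo, ← intervalIntegral.integral_of_le hR, integral_pow,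
      Nat.cast_sub hn]
    simp [Nat.sub_add_cancel hn, hn.ne']
  · exact ((continuous_pow _).integrableOn_Icc).mono_set Set.Ioo_subset_Icc_self
  · filter_upwards [ae_restrict_mem measurableSet_Ioo] with r hr
    exact pow_nonneg hr.1.le _

lemma lint_chord (m n : ℕ) (hn : m < n) {R l h : ℝ} (hR : 0 < R) (hl : 0 ≤ l) (hh : h ≤ 1)
    (hsum : R + l = 2 * h) :
    ∫⁻ r in Set.Ioo 0 R, ENNReal.ofReal (r ^ (n - 1)) * ENNReal.ofReal ((l + r) / (h * r)) ^ m ≤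
      2 ^ (m + 1) * (ENNReal.ofReal (1 ^ n / n) + ENNReal.ofReal (R ^ n / n)) := by
  have h0 : 0 < h := by linarith
  have hn0 : 0 < n := by omega
  have hn' : (0 : ℝ) < n := by exact_mod_cast hn0
  obtain ⟨j, rfl⟩ : ∃ j, n = m + j + 1 := ⟨n - m - 1, by omega⟩
  set n := m + j + 1 with hnd
  set C : ℝ := 2 ^ m * (1 + R ^ n) with hC
  have hC0 : 0 ≤ C := by positivity
  have hpt : ∀ r ∈ Set.Ioo 0 R, ENNReal.ofReal (r ^ (n - 1)) *
      ENNReal.ofReal ((l + r) / (h * r)) ^ m ≤ ENNReal.ofReal (C * ((r + l) / (2 * h)) ^ (n - 1)) := by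
    rintro r ⟨hr0, hrR⟩
    rw [← ENNReal.ofReal_pow (by positivity), ← ENNReal.ofReal_mul (by positivity)]
    apply ENNReal.ofReal_le_ofReal
    have e1 : n - 1 = m + j := by omega
    rw [e1]
    have h1 : r ≤ R * ((r + l) / (2 * h)) := by
      rw [← hsum, mul_div_assoc', le_div_iff₀ (by positivity)]
      nlinarith
    have h2 : r ^ j ≤ (1 + R ^ n) * ((r + l) / (2 * h)) ^ j := by
      calc r ^ j ≤ (R * ((r + l) / (2 * h))) ^ j := by gcongr
        _ = R ^ j * ((r + l) / (2 * h)) ^ j := mul_pow _ _ _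
        _ ≤ _ := by
          gcongr
          rcases le_total R 1 with hR1 | hR1
          · have := pow_le_one₀ hR.le hR1 (n := j)
            have : 0 ≤ R ^ n := by positivity
            linarith
          · have := pow_le_pow_right₀ hR1 (show j ≤ n by omega)
            linarith
    calc r ^ (m + j) * ((l + r) / (h * r)) ^ m = ((l + r) / h) ^ m * r ^ j := by
          rw [pow_add, div_pow, div_pow, mul_pow]; field_simp
      _ ≤ ((l + r) / h) ^ m * ((1 + R ^ n) * ((r + l) / (2 * h)) ^ j) := by gcongr
      _ = C * ((r + l) / (2 * h)) ^ (m + j) := by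
          rw [hC, pow_add, add_comm l r]
          have : (r + l) / h = 2 * ((r + l) / (2 * h)) := by field_simp
          rw [this, mul_pow]
          ring
  have hcont : Continuous fun r : ℝ => C * ((r + l) / (2 * h)) ^ (n - 1) := by fun_prop
  have hint : ∫ r in (0 : ℝ)..R, C * ((r + l) / (2 * h)) ^ (n - 1) ≤ C * (2 / n) := by
    have hd : ∀ r ∈ Set.uIcc 0 R, HasDerivAt (fun r : ℝ => C * (2 * h / n * ((r + l) / (2 * h)) ^ n))
        (C * ((r + l) / (2 * h)) ^ (n - 1)) r := by
      intro r _
      have hd1 : HasDerivAt (fun r : ℝ => (r + l) / (2 * h)) (1 / (2 * h)) r :=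
        ((hasDerivAt_id r).add_const l).div_const _
      have := ((hd1.pow n).const_mul (2 * h / n)).const_mul C
      refine this.congr_deriv ?_
      field_simp
    rw [intervalIntegral.integral_eq_sub_of_hasDerivAt hd (hcont.intervalIntegrable _ _)]
    rw [hsum, div_self (by positivity), ← mul_sub]
    apply mul_le_mul_of_nonneg_left _ hC0
    have : 0 ≤ 2 * h / n * ((0 + l) / (2 * h)) ^ n := by positivity
    have h3 : 2 * h / n ≤ 2 / n := by gcongr; linarith
    rw [one_pow]
    linarith
  calc _ ≤ ∫⁻ r in Set.Ioo 0 R, ENNReal.ofReal (C * ((r + l) / (2 * h)) ^ (n - 1)) :=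
        setLIntegral_mono' measurableSet_Ioo hpt
    _ = ENNReal.ofReal (∫ r in (0 : ℝ)..R, C * ((r + l) / (2 * h)) ^ (n - 1)) := by
        rw [← ofReal_integral_eq_lintegral_ofReal, intervalIntegral.integral_of_le hR.le,
          integral_Ioc_eq_integral_Ioo]
        · exact (hcont.integrableOn_Icc).mono_set Set.Ioo_subset_Icc_self
        · filter_upwards [ae_restrict_mem measurableSet_Ioo] with r hr
          have := hr.1
          simp only [Pi.zero_apply]
          positivity
    _ ≤ ENNReal.ofReal (C * (2 / n)) := ENNReal.ofReal_le_ofReal hint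
    _ = _ := by
        rw [← ENNReal.ofReal_add (by positivity) (by positivity)]
        have : (2 : ENNReal) ^ (m + 1) = ENNReal.ofReal (2 ^ (m + 1)) := by
          rw [ENNReal.ofReal_pow (by norm_num)]; simp
        rw [this, ← ENNReal.ofReal_mul (by positivity)]
        congr 1
        rw [hC]
        ring

section Avg
variable {E : Type*} [NormedAddCommGroup E] [InnerProductSpace ℝ E] [MeasurableSpace E]
  [BorelSpace E] [FiniteDimensional ℝ E]

lemma lint_polar (μ : Measure E) [μ.IsAddHaarMeasure] [Nontrivial E] {f : E → ENNReal}
    (hf : Measurable f) :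
    ∫⁻ z, f z ∂μ = ∫⁻ u : Metric.sphere (0 : E) 1, (∫⁻ r in Set.Ioi (0 : ℝ),
      ENNReal.ofReal (r ^ (Module.finrank ℝ E - 1)) * f (r • (u : E))) ∂μ.toSphere := by
  have h1 : ∫⁻ z, f z ∂μ = ∫⁻ z : ({(0)}ᶜ : Set E), f z ∂(μ.comap (↑)) := by
    rw [lintegral_subtype_comap (measurableSet_singleton _).compl, restrict_compl_singleton]
  have h2 := μ.measurePreserving_homeomorphUnitSphereProd.lintegral_comp_emb
    (Homeomorph.measurableEmbedding _) (fun w => f ((w.2 : ℝ) • (w.1 : E)))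
  have h3 : ∀ z : ({(0)}ᶜ : Set E), f (((homeomorphUnitSphereProd E z).2 : ℝ) •
      ((homeomorphUnitSphereProd E z).1 : E)) = f z := by
    intro z
    congr 1
    have : ‖(z : E)‖ ≠ 0 := norm_ne_zero_iff.2 z.2
    simp [smul_smul, this]
  rw [h1, ← lintegral_congr h3, h2, lintegral_prod _ (by fun_prop)]
  refine lintegral_congr fun u => ?_
  rw [Measure.volumeIoiPow, lintegral_withDensity_eq_lintegral_mul _ (by fun_prop) (by fun_prop)]
  exact lintegral_subtype_comap measurableSet_Ioi
    (fun r : ℝ => ENNReal.ofReal (r ^ (Module.finrank ℝ E - 1)) * f (r • (u : E)))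

lemma gG_measurable : Measurable fun w : E × E => gG w.1 w.2 := by
  unfold gG gT gH gU
  fun_prop

lemma gG_measurable_left (x : E) : Measurable fun a : E => gG a x := by
  unfold gG gT gH gU
  fun_prop

lemma gG_average (μ : Measure E) [μ.IsAddHaarMeasure] {m : ℕ} (hm : m < Module.finrank ℝ E)
    {x : E} (hx : ‖x‖ ≤ 1) :
    ∫⁻ a in Metric.ball (0 : E) 1, ENNReal.ofReal (gG a x) ^ m ∂μ ≤
      2 ^ (m + 2) * μ (Metric.ball 0 1) := by
  have : Nontrivial E := Module.nontrivial_of_finrank_pos (R := ℝ) (by omega)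
  set n := Module.finrank ℝ E with hn
  set B := Metric.ball (0 : E) 1 with hB
  have hBm : MeasurableSet B := Metric.isOpen_ball.measurableSet
  have hGm : Measurable fun a : E => ENNReal.ofReal (gG a x) ^ m := by
    have := gG_measurable_left x
    exact this.ennreal_ofReal.pow_const m
  set f1 : E → ENNReal := fun z => B.indicator (fun a => ENNReal.ofReal (gG a x) ^ m) (x - z) with hf1
  set f2 : E → ENNReal := B.indicator 1 with hf2
  set f3 : E → ENNReal := fun z => B.indicator 1 (x - z) with hf3
  have m1 : Measurable f1 := (hGm.indicator hBm).comp (by fun_prop)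
  have m2 : Measurable f2 := measurable_one.indicator hBm
  have m3 : Measurable f3 := (measurable_one.indicator hBm).comp (by fun_prop)
  have e1 : ∫⁻ z, f1 z ∂μ = ∫⁻ a in B, ENNReal.ofReal (gG a x) ^ m ∂μ := by
    rw [← lintegral_indicator hBm]
    exact lintegral_sub_left_eq_self (μ := μ)
      (B.indicator (fun a => ENNReal.ofReal (gG a x) ^ m)) x
  have e2 : ∫⁻ z, f2 z ∂μ = μ B := by rw [lintegral_indicator_one hBm]
  have e3 : ∫⁻ z, f3 z ∂μ = μ B := by
    rw [← lintegral_indicator_one hBm]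
    exact lintegral_sub_left_eq_self (μ := μ) (B.indicator 1) x
  have key : ∀ u : Metric.sphere (0 : E) 1,
      ∫⁻ r in Set.Ioi (0 : ℝ), ENNReal.ofReal (r ^ (n - 1)) * f1 (r • (u : E)) ≤
      ∫⁻ r in Set.Ioi (0 : ℝ), ENNReal.ofReal (r ^ (n - 1)) *
        (2 ^ (m + 1) * (f2 (r • (u : E)) + f3 (r • (u : E)))) := by
    rintro ⟨u, hu'⟩
    have hu : ‖u‖ = 1 := by simpa using hu'
    simp only
    set c : ℝ := inner ℝ x u with hc
    set h : ℝ := √(1 - ‖x‖ ^ 2 + c ^ 2) with hh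
    have hx2 : ‖x‖ ^ 2 ≤ 1 := by nlinarith [norm_nonneg x]
    have hsq : h ^ 2 = 1 - ‖x‖ ^ 2 + c ^ 2 := Real.sq_sqrt (by nlinarith [sq_nonneg c])
    have hh0 : 0 ≤ h := Real.sqrt_nonneg _
    have hcx : c ^ 2 ≤ ‖x‖ ^ 2 := by
      have := abs_real_inner_le_norm x u
      rw [hu, mul_one] at this
      exact sq_le_sq' (neg_le_of_abs_le this) (le_of_abs_le this)
    have hh1 : h ≤ 1 := by nlinarith
    have hch : |c| ≤ h := abs_le_of_sq_le_sq (by nlinarith) hh0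
    have hc1 := neg_le_of_abs_le hch
    have hc2 := le_of_abs_le hch
    have hau : ∀ r : ℝ, inner ℝ (x - r • u) u = c - r := by
      intro r
      rw [inner_sub_left, inner_smul_left, real_inner_self_eq_norm_sq, hu]
      simp [hc]
    have han : ∀ r : ℝ, ‖x - r • u‖ ^ 2 = ‖x‖ ^ 2 - 2 * r * c + r ^ 2 := by
      intro r
      rw [norm_sub_sq_real, norm_smul, hu, inner_smul_right]
      simp [hc]
      ring
    have hmem : ∀ r : ℝ, 0 < r → (x - r • u ∈ B ↔ r < c + h) := by
      intro r hr
      rw [hB, mem_ball_zero_iff]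
      have h1 : ‖x - r • u‖ < 1 ↔ ‖x - r • u‖ ^ 2 < 1 := by
        rw [sq_lt_one_iff₀ (norm_nonneg _)]
      rw [h1, han]
      constructor
      · intro h2
        by_contra h3
        push Not at h3
        nlinarith
      · intro h2
        nlinarith
    have hmem2 : ∀ r : ℝ, 0 < r → (r • u ∈ B ↔ r < 1) := by
      intro r hr
      rw [hB, mem_ball_zero_iff, norm_smul, hu, mul_one, Real.norm_of_nonneg hr.le]
    have hGr : ∀ r : ℝ, 0 < r → gG (x - r • u) x = (h - c + r) / (h * r) := by
      intro r hr
      have hU : gU (x - r • u) x = u := by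
        unfold gU
        rw [_root_.sub_sub_cancel, norm_smul, hu, mul_one, Real.norm_of_nonneg hr.le, smul_smul,
          inv_mul_cancel₀ hr.ne', one_smul]
      have hHr : gH (x - r • u) x = h := by
        unfold gH
        rw [hU, hau, han, hh]
        congr 1
        ring
      unfold gG gT
      rw [hHr, hU, hau, _root_.sub_sub_cancel, norm_smul, hu, mul_one, Real.norm_of_nonneg hr.le]
      congr 1
      ring
    have hconv : ∀ (R : ℝ) (g : ℝ → ENNReal) (F : ℝ → ENNReal),
        (∀ r, 0 < r → r < R → F r = g r) → (∀ r, 0 < r → ¬ r < R → F r = 0) →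
        ∫⁻ r in Set.Ioi (0 : ℝ), ENNReal.ofReal (r ^ (n - 1)) * F r =
        ∫⁻ r in Set.Ioo 0 R, ENNReal.ofReal (r ^ (n - 1)) * g r := by
      intro R g F hF1 hF2
      have : Set.Ioo 0 R = Set.Ioi 0 ∩ Set.Iio R := by ext; simp
      rw [this, Set.inter_comm, ← setLIntegral_indicator measurableSet_Iio]
      refine setLIntegral_congr_fun measurableSet_Ioi ?_
      intro r hr
      by_cases h1 : r < R
      · simp [Set.indicator, h1, hF1 r hr h1]
      · simp [Set.indicator, h1, hF2 r hr h1]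
    have I1 := hconv (c + h) (fun r => ENNReal.ofReal ((h - c + r) / (h * r)) ^ m)
      (fun r => f1 (r • u))
      (by intro r hr h1
          simp only [hf1]
          rw [Set.indicator_of_mem ((hmem r hr).2 h1), hGr r hr])
      (by intro r hr h1
          simp only [hf1]
          rw [Set.indicator_of_notMem (fun h2 => h1 ((hmem r hr).1 h2))])
    have I2 := hconv 1 (fun _ => 1) (fun r => f2 (r • u))
      (by intro r hr h1
          simp only [hf2]
          rw [Set.indicator_of_mem ((hmem2 r hr).2 h1), Pi.one_apply])
      (by intro r hr h1
          simp only [hf2]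
          rw [Set.indicator_of_notMem (fun h2 => h1 ((hmem2 r hr).1 h2))])
    have I3 := hconv (c + h) (fun _ => 1) (fun r => f3 (r • u))
      (by intro r hr h1
          simp only [hf3]
          rw [Set.indicator_of_mem ((hmem r hr).2 h1), Pi.one_apply])
      (by intro r hr h1
          simp only [hf3]
          rw [Set.indicator_of_notMem (fun h2 => h1 ((hmem r hr).1 h2))])
    simp only [mul_one] at I2 I3
    rw [lint_pow n (by omega) zero_le_one] at I2
    rw [lint_pow n (by omega) (by linarith)] at I3
    have hsplit : ∫⁻ r in Set.Ioi (0 : ℝ), ENNReal.ofReal (r ^ (n - 1)) *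
        (2 ^ (m + 1) * (f2 (r • u) + f3 (r • u))) =
        2 ^ (m + 1) * (ENNReal.ofReal (1 ^ n / n) + ENNReal.ofReal ((c + h) ^ n / n)) := by
      rw [← I2, ← I3, ← lintegral_add_left (by fun_prop), ← lintegral_const_mul _ (by fun_prop)]
      refine lintegral_congr fun r => ?_
      ring
    rw [hsplit, I1]
    rcases (show 0 ≤ c + h by linarith).eq_or_lt with h0 | h0
    · simp [← h0]
    · exact lint_chord m n hm h0 (by linarith) hh1 (by ring)
  calc ∫⁻ a in B, ENNReal.ofReal (gG a x) ^ m ∂μ = ∫⁻ z, f1 z ∂μ := e1.symm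
    _ ≤ ∫⁻ z, 2 ^ (m + 1) * (f2 z + f3 z) ∂μ := by
        rw [lint_polar μ m1, lint_polar μ (by fun_prop)]
        exact lintegral_mono key
    _ = 2 ^ (m + 2) * μ B := by
        rw [lintegral_const_mul _ (by fun_prop), lintegral_add_left m2, e2, e3]
        ring

end Avg

/-! ### Part 5: the case of finite mass -/

lemma finite_case (k p : ℕ) (hp : p + 1 < k)
    (V : ZChain p (EuclideanSpace ℝ (Fin k)))
    (W : ZChain (p + 1) (EuclideanSpace ℝ (Fin k)))
    (hWcont : ∀ τ ∈ W.support, Continuous τ)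
    (hV : chainIn V (Metric.sphere 0 1))
    (hW : chainIn W (Metric.closedBall 0 1))
    (hbd : chainBd W = V) (hfin : chainMass W ≠ ⊤) :
    ∃ W' : ZChain (p + 1) (EuclideanSpace ℝ (Fin k)),
      (∀ τ ∈ W'.support, Continuous τ) ∧
      chainIn W' (Metric.sphere 0 1) ∧
      chainBd W' = V ∧
      chainMass W' ≤
        ENNReal.ofReal (2 ^ (p + 1) * (1 + 2 * Real.pi)) * chainMass W := by
  have hk : Module.finrank ℝ (EuclideanSpace ℝ (Fin k)) = k := by simp
  set K : ((Fin (p + 2) → ℝ) → (EuclideanSpace ℝ (Fin k))) → Set (EuclideanSpace ℝ (Fin k)) := fun τ => τ '' stdSimplex ℝ (Fin (p + 2)) with hKdef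
  have hKc : ∀ τ ∈ W.support, IsCompact (K τ) := fun τ hτ =>
    (isCompact_stdSimplex ℝ (Fin (p + 2))).image (hWcont τ hτ)
  have hmass : chainMass W = ∑ τ ∈ W.support, μH[((p + 1 : ℕ) : ℝ)] (K τ) := rfl
  have hKfin : ∀ τ ∈ W.support, μH[((p + 1 : ℕ) : ℝ)] (K τ) ≠ ⊤ := by
    intro τ hτ
    rw [hmass] at hfin
    exact (ENNReal.sum_ne_top.1 hfin) τ hτ
  set μ : Measure (EuclideanSpace ℝ (Fin k)) := μH[(Module.finrank ℝ (EuclideanSpace ℝ (Fin k)) : ℝ)] with hμ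
  have hKnull : ∀ τ ∈ W.support, μ (K τ) = 0 := by
    intro τ hτ
    have hlt : ((p + 1 : ℕ) : ℝ) < (Module.finrank ℝ (EuclideanSpace ℝ (Fin k)) : ℝ) := by rw [hk]; exact_mod_cast hp
    exact (Measure.hausdorffMeasure_zero_or_top hlt (K τ)).resolve_right (hKfin τ hτ)
  set B := Metric.ball (0 : (EuclideanSpace ℝ (Fin k))) 1 with hB
  have hBm : MeasurableSet B := Metric.isOpen_ball.measurableSet
  have hB0 : μ B ≠ 0 := (Metric.measure_ball_pos μ 0 one_pos).ne'
  have hBt : μ B ≠ ⊤ := measure_ball_lt_top.ne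
  set F : (EuclideanSpace ℝ (Fin k)) → ENNReal := fun a =>
    ∑ τ ∈ W.support, ∫⁻ x in K τ, ENNReal.ofReal (gG a x) ^ (p + 1) ∂μH[((p + 1 : ℕ) : ℝ)] with hF
  have hmeas : Measurable fun w : (EuclideanSpace ℝ (Fin k)) × (EuclideanSpace ℝ (Fin k)) => ENNReal.ofReal (gG w.1 w.2) ^ (p + 1) :=
    gG_measurable.ennreal_ofReal.pow_const (p + 1)
  have hsf : ∀ τ ∈ W.support, IsFiniteMeasure ((μH[((p + 1 : ℕ) : ℝ)] : Measure (EuclideanSpace ℝ (Fin k))).restrict (K τ)) := by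
    intro τ hτ
    exact ⟨by rw [Measure.restrict_apply_univ]; exact (hKfin τ hτ).lt_top⟩
  have hFm : Measurable F := by
    refine Finset.measurable_sum _ fun τ hτ => ?_
    have := hsf τ hτ
    exact hmeas.lintegral_prod_right'
  have hFint : ∫⁻ a in B, F a ∂μ ≤ 2 ^ ((p + 1) + 2) * μ B * chainMass W := by
    rw [hmass, Finset.mul_sum, hF, lintegral_finsetSum']
    · refine Finset.sum_le_sum fun τ hτ => ?_
      have := hsf τ hτ
      rw [lintegral_lintegral_swap hmeas.aemeasurable, ← setLIntegral_const]
      refine setLIntegral_mono' (hKc τ hτ).measurableSet fun x hx => ?_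
      refine gG_average μ (by omega) ?_
      simpa using hW τ hτ hx
    · intro τ hτ
      have := hsf τ hτ
      exact hmeas.lintegral_prod_right'.aemeasurable
  have hN : (μ.restrict B) ((⋃ τ ∈ W.support, K τ) ∪ Bᶜ) = 0 := by
    rw [measure_union_null_iff]
    refine ⟨?_, ?_⟩
    · refine Measure.restrict_le_self.absolutelyContinuous ?_
      exact (measure_biUnion_null_iff W.support.countable_toSet).2 hKnull
    · rw [Measure.restrict_apply hBm.compl]
      simp
  have : IsFiniteMeasure (μ.restrict B) :=
    ⟨by rw [Measure.restrict_apply_univ]; exact hBt.lt_top⟩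
  obtain ⟨a, haN, haF⟩ := exists_notMem_null_le_laverage (μ := μ.restrict B) (f := F)
    (by rwa [Ne, Measure.restrict_eq_zero]) hFm.aemeasurable hN
  rw [Set.mem_union, not_or, Set.mem_compl_iff, not_not] at haN
  obtain ⟨haK, haB⟩ := haN
  have ha : ‖a‖ < 1 := by simpa [hB] using haB
  have haK' : ∀ τ ∈ W.support, a ∉ K τ := by
    intro τ hτ h
    exact haK (Set.mem_biUnion hτ h)
  have haF' : F a ≤ 2 ^ ((p + 1) + 2) * chainMass W := by
    refine haF.trans ?_
    rw [setLAverage_eq]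
    refine ENNReal.div_le_of_le_mul ?_
    calc _ ≤ _ := hFint
      _ = _ := by ring
  obtain ⟨W', h1, h2, h3, h4⟩ := push_chain V W hWcont hbd (fun σ => gP a ∘ σ) (fun τ => gP a ∘ τ)
    (by intro τ i y _; rfl)
    (by
      intro τ hτ x hx
      refine ContinuousAt.continuousWithinAt ?_
      refine ContinuousAt.comp (gP_cont ?_) (hWcont τ hτ).continuousAt
      intro h
      exact haK' τ hτ ⟨x, hx, h⟩)
    (by
      intro σ hσ y hy
      refine gP_sphere ha ?_
      simpa using hV σ hσ ⟨y, hy, rfl⟩)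
    (by
      rintro τ hτ _ ⟨x, hx, rfl⟩
      rw [mem_sphere_zero_iff_norm]
      exact gP_norm ha fun h => haK' τ hτ ⟨x, hx, h⟩)
  refine ⟨W', h1, h2, h3, h4.trans ?_⟩
  set q : ℝ := (7 / 4 : ℝ) ^ (((2 * (p + 1) : ℕ) : ℝ)⁻¹) with hq
  have hq1 : 1 < q := Real.one_lt_rpow (by norm_num) (by positivity)
  have hqp : q ^ (2 * (p + 1)) = 7 / 4 := Real.rpow_inv_natCast_pow (by norm_num) (by omega)
  calc ∑ τ ∈ W.support, μH[((p + 1 : ℕ) : ℝ)] (gP a ∘ τ '' stdSimplex ℝ (Fin (p + 2)))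
      ≤ ∑ τ ∈ W.support, ENNReal.ofReal (q ^ 2) ^ (p + 1) *
        ∫⁻ x in K τ, ENNReal.ofReal (gG a x) ^ (p + 1) ∂μH[((p + 1 : ℕ) : ℝ)] := by
        refine Finset.sum_le_sum fun τ hτ => ?_
        rw [Set.image_comp]
        exact gP_hausdorff ha (hKc τ hτ) (haK' τ hτ) hq1 (p + 1)
    _ = ENNReal.ofReal (7 / 4) * F a := by
        rw [← Finset.mul_sum, ← ENNReal.ofReal_pow (by positivity), ← pow_mul, hqp]
    _ ≤ ENNReal.ofReal (7 / 4) * (2 ^ ((p + 1) + 2) * chainMass W) := by gcongr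
    _ = ENNReal.ofReal (2 ^ (p + 1) * 7) * chainMass W := by
        have : (2 : ENNReal) ^ ((p + 1) + 2) = ENNReal.ofReal (2 ^ ((p + 1) + 2)) := by
          rw [ENNReal.ofReal_pow (by norm_num)]; simp
        rw [this, ← mul_assoc, ← ENNReal.ofReal_mul (by norm_num)]
        congr 2
        ring
    _ ≤ _ := by
        gcongr
        linarith [Real.pi_gt_three]

/-! ### Part 6: the case of infinite mass -/

/-- a smooth bump partition of unity on the line -/
noncomputable def bW (N : ℕ) (t : ℝ) (j : ℕ) : ℝ :=
  Real.smoothTransition (N * t - j + 1) - Real.smoothTransition (N * t - j)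

lemma bW_nonneg (N : ℕ) (t : ℝ) (j : ℕ) : 0 ≤ bW N t j :=
  sub_nonneg.2 (Real.smoothTransition.monotone (by linarith))

lemma bW_zero (N j : ℕ) : bW N 0 j = if j = 0 then 1 else 0 := by
  unfold bW
  rcases Nat.eq_zero_or_pos j with rfl | hj
  · simp
  · have h1 : (1 : ℝ) ≤ j := by exact_mod_cast hj
    rw [Real.smoothTransition.zero_of_nonpos (by simp; linarith),
      Real.smoothTransition.zero_of_nonpos (by simp)]
    simp [hj.ne']

lemma bW_support {N : ℕ} {t : ℝ} {j : ℕ} (h : bW N t j ≠ 0) : |(j : ℝ) - N * t| ≤ 1 := by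
  by_contra hc
  apply h
  unfold bW
  rcases lt_abs.1 (not_le.1 hc) with h1 | h1
  · rw [Real.smoothTransition.zero_of_nonpos (by linarith),
      Real.smoothTransition.zero_of_nonpos (by linarith), sub_zero]
  · rw [Real.smoothTransition.one_of_one_le (by linarith),
      Real.smoothTransition.one_of_one_le (by linarith), sub_self]

lemma bW_sum (N : ℕ) {t : ℝ} (h0 : 0 ≤ t) (h1 : t ≤ 1) : ∑ j : Fin (N + 1), bW N t j = 1 := by
  rw [Fin.sum_univ_eq_sum_range (fun j => bW N t j)]
  have := Finset.sum_range_sub' (fun j : ℕ => Real.smoothTransition (N * t - j + 1)) (N + 1)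
  have h2 : ∀ j : ℕ, bW N t j = Real.smoothTransition (N * t - j + 1) -
      Real.smoothTransition (N * t - (j + 1 : ℕ) + 1) := by
    intro j
    unfold bW
    congr 2
    push_cast
    ring
  rw [Finset.sum_congr rfl fun j _ => h2 j, this]
  have hN : (0 : ℝ) ≤ N := Nat.cast_nonneg N
  rw [Real.smoothTransition.one_of_one_le (by push_cast; nlinarith),
    Real.smoothTransition.zero_of_nonpos (by push_cast; nlinarith), sub_zero]

lemma bW_contDiff (N j : ℕ) : ContDiff ℝ 1 fun t => bW N t j := by
  unfold bW
  have : ContDiff ℝ ((1 : ℕ∞) : WithTop ℕ∞) Real.smoothTransition := Real.smoothTransition.contDiff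
  have h : ContDiff ℝ 1 Real.smoothTransition := by exact_mod_cast this
  exact (h.comp (by fun_prop)).sub (h.comp (by fun_prop))

section Smooth
variable {E : Type*} [NormedAddCommGroup E] [NormedSpace ℝ E]

/-- natural smoothing operator on singular simplices -/
noncomputable def bS (N : ℕ) {n : ℕ} (τ : (Fin n → ℝ) → E) (x : Fin n → ℝ) : E :=
  ∑ α : Fin n → Fin (N + 1), (∏ i, bW N (x i) (α i)) • τ (pRho fun i => ((α i : ℕ) : ℝ))

lemma bS_contDiff (N : ℕ) {n : ℕ} (τ : (Fin n → ℝ) → E) : ContDiff ℝ 1 (bS N τ) := by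
  unfold bS
  refine ContDiff.sum fun α _ => ContDiff.smul ?_ contDiff_const
  refine contDiff_prod fun i _ => ?_
  exact (bW_contDiff N (α i)).comp (contDiff_apply ℝ ℝ i)

lemma bS_ins (N : ℕ) {n : ℕ} (τ : (Fin (n + 1) → ℝ) → E) (i : Fin (n + 1)) (y : Fin n → ℝ) :
    bS N τ (i.insertNth (0 : ℝ) y) = bS N (fun x => τ (i.insertNth (0 : ℝ) x)) y := by
  unfold bS
  rw [← (Fin.insertNthEquiv (fun _ => Fin (N + 1)) i).sum_comp, Fintype.sum_prod_type]
  rw [Finset.sum_eq_single (0 : Fin (N + 1))]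
  · refine Finset.sum_congr rfl fun β _ => ?_
    congr 1
    · rw [Fin.prod_univ_succAbove _ i]
      simp [bW_zero]
    · show τ _ = τ (i.insertNth (0 : ℝ) (pRho fun i => ((β i : ℕ) : ℝ)))
      rw [← pRho_ins]
      congr 2
      ext j
      refine Fin.succAboveCases i ?_ (fun j => ?_) j <;> simp
  · intro b _ hb
    refine Finset.sum_eq_zero fun β _ => ?_
    rw [Fin.prod_univ_succAbove _ i]
    simp [bW_zero, hb]
  · simp

lemma bS_weight_sum (N : ℕ) {n : ℕ} {x : Fin n → ℝ} (hx : x ∈ stdSimplex ℝ (Fin n)) :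
    ∑ α : Fin n → Fin (N + 1), ∏ i, bW N (x i) (α i) = 1 := by
  have h1 : ∀ i, x i ≤ 1 := fun i => by
    rw [← hx.2]
    exact Finset.single_le_sum (fun j _ => hx.1 j) (Finset.mem_univ i)
  have := Finset.prod_univ_sum (fun _ : Fin n => (Finset.univ : Finset (Fin (N + 1))))
    (fun i j => bW N (x i) j)
  rw [Fintype.piFinset_univ] at this
  rw [← this]
  exact Finset.prod_eq_one fun i _ => bW_sum N (hx.1 i) (h1 i)

lemma sample_close {N n : ℕ} (hN : n < N) {x : Fin n → ℝ} (hx : x ∈ stdSimplex ℝ (Fin n))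
    {α : Fin n → Fin (N + 1)} (hα : ∏ i, bW N (x i) (α i) ≠ 0) :
    (pRho fun i => ((α i : ℕ) : ℝ)) ∈ stdSimplex ℝ (Fin n) ∧
    dist (pRho fun i => ((α i : ℕ) : ℝ)) x ≤ (n + 1 : ℝ) / ((N : ℝ) - n) := by
  have hN' : (n : ℝ) < N := by exact_mod_cast hN
  have hc : ∀ i, |((α i : ℕ) : ℝ) - N * x i| ≤ 1 := fun i =>
    bW_support (Finset.prod_ne_zero_iff.1 hα i (Finset.mem_univ i))
  have hA : pLam (fun i => ((α i : ℕ) : ℝ)) = ∑ i, ((α i : ℕ) : ℝ) :=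
    Finset.sum_congr rfl fun i _ => max_eq_left (Nat.cast_nonneg _)
  set A := ∑ i, ((α i : ℕ) : ℝ) with hAd
  have hAN : |A - N| ≤ n := by
    have : A - N = ∑ i, (((α i : ℕ) : ℝ) - N * x i) := by
      rw [Finset.sum_sub_distrib, ← Finset.mul_sum, hx.2, mul_one]
    rw [this]
    calc _ ≤ ∑ i, |((α i : ℕ) : ℝ) - N * x i| := Finset.abs_sum_le_sum_abs _ _
      _ ≤ ∑ _i : Fin n, (1 : ℝ) := Finset.sum_le_sum fun i _ => hc i
      _ = n := by simp
  have hA0 : (N : ℝ) - n ≤ A := by linarith [neg_le_of_abs_le hAN]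
  have hApos : 0 < A := by linarith
  refine ⟨pRho_mem _ (by rw [hA]; exact hApos), ?_⟩
  refine (dist_pi_le_iff (div_nonneg (by positivity) (by linarith))).2 fun i => ?_
  have hx1 : x i ≤ 1 := by
    rw [← hx.2]
    exact Finset.single_le_sum (fun j _ => hx.1 j) (Finset.mem_univ i)
  rw [Real.dist_eq]
  have e : pRho (fun i => ((α i : ℕ) : ℝ)) i - x i =
      ((((α i : ℕ) : ℝ) - N * x i) - x i * (A - N)) / A := by
    simp only [pRho]
    rw [hA, max_eq_left (Nat.cast_nonneg _)]
    field_simp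
    ring
  rw [e, abs_div, abs_of_pos hApos]
  refine div_le_div₀ (by positivity) ?_ (by linarith) hA0
  calc _ ≤ |((α i : ℕ) : ℝ) - N * x i| + |x i * (A - N)| := abs_sub _ _
    _ ≤ 1 + 1 * n := by
        rw [abs_mul, abs_of_nonneg (hx.1 i)]
        exact add_le_add (hc i) (mul_le_mul hx1 hAN (abs_nonneg _) zero_le_one)
    _ = _ := by ring

lemma bS_approx {n : ℕ} (τ : (Fin n → ℝ) → E) (hτ : Continuous τ) {ε : ℝ} (hε : 0 < ε) :
    ∀ᶠ N : ℕ in Filter.atTop, ∀ x ∈ stdSimplex ℝ (Fin n), ‖bS N τ x - τ x‖ ≤ ε := by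
  have huc : UniformContinuousOn τ (stdSimplex ℝ (Fin n)) :=
    (isCompact_stdSimplex ℝ (Fin n)).uniformContinuousOn_of_continuous hτ.continuousOn
  obtain ⟨δ, hδ, hδ'⟩ := Metric.uniformContinuousOn_iff.1 huc ε hε
  have hlim : Filter.Tendsto (fun N : ℕ => (n + 1 : ℝ) / ((N : ℝ) - n)) Filter.atTop (nhds 0) := by
    refine Filter.Tendsto.div_atTop tendsto_const_nhds ?_
    exact Filter.tendsto_atTop_add_const_right _ (-(n : ℝ)) tendsto_natCast_atTop_atTop
  filter_upwards [hlim.eventually_lt_const hδ, Filter.eventually_gt_atTop n] with N h1 h2 x hx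
  have hs := bS_weight_sum N hx
  have e : bS N τ x - τ x = ∑ α : Fin n → Fin (N + 1), (∏ i, bW N (x i) (α i)) •
      (τ (pRho fun i => ((α i : ℕ) : ℝ)) - τ x) := by
    simp only [smul_sub, Finset.sum_sub_distrib, ← Finset.sum_smul, hs, one_smul]
    rfl
  rw [e]
  calc _ ≤ ∑ α : Fin n → Fin (N + 1), ‖(∏ i, bW N (x i) (α i)) •
      (τ (pRho fun i => ((α i : ℕ) : ℝ)) - τ x)‖ := norm_sum_le _ _
    _ ≤ ∑ α : Fin n → Fin (N + 1), (∏ i, bW N (x i) (α i)) * ε := by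
        refine Finset.sum_le_sum fun α _ => ?_
        have hw : 0 ≤ ∏ i, bW N (x i) (α i) := Finset.prod_nonneg fun i _ => bW_nonneg _ _ _
        rw [norm_smul, Real.norm_of_nonneg hw]
        by_cases h0 : ∏ i, bW N (x i) (α i) = 0
        · simp [h0]
        · obtain ⟨h3, h4⟩ := sample_close h2 hx h0
          refine mul_le_mul_of_nonneg_left ?_ hw
          rw [← dist_eq_norm]
          exact (hδ' _ h3 _ hx (h4.trans_lt h1)).le
    _ = ε := by rw [← Finset.sum_mul, hs, one_mul]

/-- smoothing in the interior, leaving points on the sphere fixed -/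
noncomputable def bB (N : ℕ) {n : ℕ} (τ : (Fin n → ℝ) → E) (x : Fin n → ℝ) : E :=
  τ x + max 0 (min 1 (2 - 2 * ‖τ x‖)) • (bS N τ x - τ x)

lemma bS_image_dimH (N : ℕ) {n : ℕ} (τ : (Fin (n + 1) → ℝ) → E) :
    dimH (bS N τ '' stdSimplex ℝ (Fin (n + 1))) ≤ n := by
  set φ : (Fin n → ℝ) → (Fin (n + 1) → ℝ) := fun y => Fin.cons (1 - ∑ i, y i) y with hφ
  have hφs : ContDiff ℝ 1 φ := by
    rw [contDiff_pi]
    intro i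
    refine Fin.cases ?_ (fun i => ?_) i
    · simp only [hφ, Fin.cons_zero]; fun_prop
    · simp only [hφ, Fin.cons_succ]; fun_prop
  have hsub : bS N τ '' stdSimplex ℝ (Fin (n + 1)) ⊆ Set.range (bS N τ ∘ φ) := by
    rintro _ ⟨x, hx, rfl⟩
    refine ⟨Fin.tail x, ?_⟩
    have : φ (Fin.tail x) = x := by
      have h := hx.2
      rw [Fin.sum_univ_succ] at h
      have h' : 1 - ∑ i, Fin.tail x i = x 0 := by
        simp only [Fin.tail]; linarith
      simp only [hφ]
      rw [h', Fin.cons_self_tail]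
    simp [this]
  refine (dimH_mono hsub).trans ?_
  have := ((bS_contDiff N τ).comp hφs).dimH_range_le
  simpa using this

end Smooth

lemma infinite_case (k p : ℕ) (hp : p + 1 < k)
    (V : ZChain p (EuclideanSpace ℝ (Fin k)))
    (W : ZChain (p + 1) (EuclideanSpace ℝ (Fin k)))
    (hWcont : ∀ τ ∈ W.support, Continuous τ)
    (hV : chainIn V (Metric.sphere 0 1))
    (hbd : chainBd W = V) :
    ∃ W' : ZChain (p + 1) (EuclideanSpace ℝ (Fin k)),
      (∀ τ ∈ W'.support, Continuous τ) ∧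
      chainIn W' (Metric.sphere 0 1) ∧
      chainBd W' = V := by
  have hall : ∀ᶠ N : ℕ in Filter.atTop, ∀ τ ∈ W.support, ∀ x ∈ stdSimplex ℝ (Fin (p + 2)),
      ‖bS N τ x - τ x‖ ≤ 1 / 8 := by
    rw [Filter.eventually_all_finset]
    intro τ hτ
    exact bS_approx τ (hWcont τ hτ) (by norm_num)
  obtain ⟨N, hN⟩ := hall.exists
  have hdim : dimH (⋃ τ ∈ W.support, bS N τ '' stdSimplex ℝ (Fin (p + 2))) <
      Module.finrank ℝ (EuclideanSpace ℝ (Fin k)) := by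
    have h1 : dimH (⋃ τ ∈ (W.support : Set ((Fin (p + 1 + 1) → ℝ) → EuclideanSpace ℝ (Fin k))), bS N τ '' stdSimplex ℝ (Fin (p + 2))) ≤
        ((p + 1 : ℕ) : ENNReal) := by
      rw [dimH_bUnion W.support.countable_toSet]
      exact iSup₂_le fun τ _ => bS_image_dimH N τ
    refine lt_of_le_of_lt h1 ?_
    simp only [finrank_euclideanSpace, Fintype.card_fin]
    exact_mod_cast hp
  obtain ⟨a, haB, haN⟩ := (dense_compl_of_dimH_lt_finrank hdim).inter_open_nonempty
    (Metric.ball 0 (1 / 4)) Metric.isOpen_ball ⟨0, by simp⟩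
  have ha4 : ‖a‖ < 1 / 4 := by simpa using haB
  have ha : ‖a‖ < 1 := by linarith
  have hne : ∀ τ ∈ W.support, ∀ x ∈ stdSimplex ℝ (Fin (p + 2)), bB N τ x ≠ a := by
    intro τ hτ x hx h
    unfold bB at h
    rcases le_or_gt ‖τ x‖ (1 / 2) with h1 | h1
    · rw [min_eq_left (by linarith), max_eq_right zero_le_one, one_smul, add_sub_cancel] at h
      exact haN (Set.mem_biUnion hτ ⟨x, hx, h⟩)
    · set c : ℝ := max 0 (min 1 (2 - 2 * ‖τ x‖)) with hc
      have hc0 : 0 ≤ c := le_max_left _ _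
      have hc1 : c ≤ 1 := max_le zero_le_one (min_le_left _ _)
      have h2 : ‖c • (bS N τ x - τ x)‖ ≤ 1 / 8 := by
        rw [norm_smul, Real.norm_of_nonneg hc0]
        have := hN τ hτ x hx
        nlinarith [norm_nonneg (bS N τ x - τ x)]
      have h3 : τ x = a - c • (bS N τ x - τ x) := by rw [← h]; abel
      have h4 : ‖τ x‖ ≤ ‖a‖ + ‖c • (bS N τ x - τ x)‖ := by
        conv_lhs => rw [h3]
        exact norm_sub_le _ _
      linarith
  obtain ⟨W', h1, h2, h3, -⟩ := push_chain V W hWcont hbd (fun σ y => gP a (bB N σ y))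
    (fun τ x => gP a (bB N τ x))
    (by
      intro τ i y _
      simp only [bB, bS_ins])
    (by
      intro τ hτ x hx
      refine ContinuousAt.continuousWithinAt ?_
      refine ContinuousAt.comp (f := bB N τ) (gP_cont (hne τ hτ x hx)) ?_
      have hc := hWcont τ hτ
      have hb := (bS_contDiff N τ).continuous
      have : Continuous (bB N τ) := by
        unfold bB
        fun_prop
      exact this.continuousAt)
    (by
      intro σ hσ y hy
      have h1 : ‖σ y‖ = 1 := by simpa using hV σ hσ ⟨y, hy, rfl⟩
      have : bB N σ y = σ y := by simp [bB, h1]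
      simp only [this]
      exact gP_sphere ha h1)
    (by
      rintro τ hτ _ ⟨x, hx, rfl⟩
      rw [mem_sphere_zero_iff_norm]
      exact gP_norm ha (hne τ hτ x hx))
  exact ⟨W', h1, h2, h3⟩

/-- Pushing a bounding chain to the boundary sphere: if a `p`-cycle `V` in
`S^{k−1}`, `p < k − 1`, bounds a `(p+1)`-chain `W` in the unit ball `B^k`, then it
bounds a `(p+1)`-chain `W̄` lying in `S^{k−1}` with
`area(W̄) ≤ 2^{p+1}(1 + 2π)·area(W)`. -/
theorem stmt_19 (k p : ℕ) (hp : p + 1 < k)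
    (V : ZChain p (EuclideanSpace ℝ (Fin k)))
    (W : ZChain (p + 1) (EuclideanSpace ℝ (Fin k)))
    (hVcont : ∀ τ ∈ V.support, Continuous τ)
    (hWcont : ∀ τ ∈ W.support, Continuous τ)
    (hV : chainIn V (Metric.sphere 0 1))
    (hW : chainIn W (Metric.closedBall 0 1))
    (hbd : chainBd W = V) :
    ∃ W' : ZChain (p + 1) (EuclideanSpace ℝ (Fin k)),
      (∀ τ ∈ W'.support, Continuous τ) ∧
      chainIn W' (Metric.sphere 0 1) ∧
      chainBd W' = V ∧
      chainMass W' ≤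
        ENNReal.ofReal (2 ^ (p + 1) * (1 + 2 * Real.pi)) * chainMass W := by
  by_cases hfin : chainMass W = ⊤
  · obtain ⟨W', h1, h2, h3⟩ := infinite_case k p hp V W hWcont hV hbd
    refine ⟨W', h1, h2, h3, ?_⟩
    rw [hfin, ENNReal.mul_top]
    · exact le_top
    · have : 0 < (2 : ℝ) ^ (p + 1) * (1 + 2 * Real.pi) := by positivity
      simpa using this
  · exact finite_case k p hp V W hWcont hV hW hbd hfin
end
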